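/- arXiv:1912.00072 — 2 statements merged into one kernel-verified Lean document; each statement's English description precedes it below -/
import Mathlib

section
/- Let R ∈ (0,∞] and let a be a locally finite nonnegative Borel measure on [0,R) (a Krein string). Then for every ξ > 0 the string equation has exactly one solution φ_ξ, the right limit φ_ξ′(0⁺) exists, and the function ψ(ξ) = −φ_ξ′(0⁺) + a({0}) ξ, defined for ξ > 0, is a complete Bernstein function. -/
open MeasureTheory Filter Set
open scoped ENNReal Topology

noncomputable section

/-- The interval `[0, R)` as a subset of `ℝ`, where `R ∈ (0, ∞]`. -/
def IsetOf (R : ℝ≥0∞) : Set ℝ := {y : ℝ | 0 ≤ y ∧ ENNReal.ofReal y < R}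

/-- `a` is a locally finite nonnegative Borel measure on `[0, R)`:
it is carried by `[0, R)` and finite on compact subsets of `[0, R)`. -/
def LocallyFiniteOnHalf (R : ℝ≥0∞) (a : MeasureTheory.Measure ℝ) : Prop :=
  a ((IsetOf R)ᶜ) = 0 ∧ ∀ y ∈ IsetOf R, a (Set.Icc 0 y) < ⊤

/-- `b` is locally square-integrable on `[0, R)`. -/
def LocL2OnHalf (R : ℝ≥0∞) (b : ℝ → ℝ) : Prop :=
  ∀ y ∈ IsetOf R, MeasureTheory.IntegrableOn (fun t => (b t) ^ 2) (Set.Icc 0 y)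

/-- A solution `φ` (with right-continuous locally-BV version `v` of `φ′`) of Krein's
string equation `φ″(dy) = ξ φ(y) a(dy)` on `(0, R)`, with `φ(0) = 1`, `φ` locally
absolutely continuous and bounded on `[0, R)`, and `φ(y) → 0` as `y → R⁻` when `R < ∞`. -/
structure IsStringSolution (R : ℝ≥0∞) (a : MeasureTheory.Measure ℝ) (ξ : ℝ)
    (φ : ℝ → ℝ) (v : ℝ → ℝ) : Prop where
  init : φ 0 = 1
  deriv_integrable : ∀ y ∈ IsetOf R, MeasureTheory.IntegrableOn v (Set.Icc 0 y)
  locAC : ∀ y ∈ IsetOf R, φ y = 1 + ∫ t in (0:ℝ)..y, v t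
  right_cont : ∀ y ∈ IsetOf R, 0 < y → ContinuousWithinAt v (Set.Ici y) y
  bounded : ∃ M : ℝ, ∀ y ∈ IsetOf R, |φ y| ≤ M
  boundary : R ≠ ⊤ →
    Filter.Tendsto φ (nhdsWithin R.toReal (Set.Iio R.toReal)) (nhds 0)
  integ_a : ∀ y ∈ IsetOf R, MeasureTheory.IntegrableOn φ (Set.Icc 0 y) a
  eqn : ∀ y₁ y₂ : ℝ, 0 < y₁ → y₁ ≤ y₂ → y₂ ∈ IsetOf R →
    v y₂ - v y₁ = ξ * ∫ y in Set.Ioc y₁ y₂, φ y ∂a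

/-- A *complete Bernstein function*: `Φ(ξ) = c₁ + c₂ ξ + ∫_{(0,∞)} ξ/(ξ+s) μ(ds)` for
some `c₁, c₂ ≥ 0` and a nonnegative Borel measure `μ` on `(0, ∞)` with
`∫_{(0,∞)} (1+s)⁻¹ μ(ds) < ∞`. -/
def IsCompleteBernstein (Φ : ℝ → ℝ) : Prop :=
  ∃ (c₁ c₂ : ℝ) (μ : MeasureTheory.Measure ℝ), 0 ≤ c₁ ∧ 0 ≤ c₂ ∧
    μ (Set.Iic 0) = 0 ∧ (∫⁻ s, ENNReal.ofReal ((1 + s)⁻¹) ∂μ) < ⊤ ∧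
    ∀ ξ : ℝ, 0 < ξ →
      MeasureTheory.Integrable (fun s : ℝ => ξ / (ξ + s)) μ ∧
      Φ ξ = c₁ + c₂ * ξ + ∫ s : ℝ, ξ / (ξ + s) ∂μ

/-- The function `t ↦ ξ / (t + ξ (1 - t))` on `[0, 1]`. With `t = s / (1 + s)` it equals
`ξ (1 + s) / (ξ + s)`, the kernel of complete Bernstein functions on `[0, ∞]`. -/
def bernsteinKernel (ξ : ℝ) (hξ : 0 < ξ) : C(unitInterval, ℝ) where
  toFun t := ξ / (t + ξ * (1 - t))
  continuous_toFun := by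
    refine Continuous.div (by fun_prop) (by fun_prop) fun t => ?_
    have h0 := t.2.1
    have h1 := t.2.2
    rcases h0.eq_or_lt with h | h
    · rw [← h]; simpa using hξ.ne'
    · have := mul_nonneg hξ.le (sub_nonneg.2 h1)
      positivity

lemma bernsteinKernel_apply (ξ : ℝ) (hξ : 0 < ξ) (t : unitInterval) :
    bernsteinKernel ξ hξ t = ξ / (t + ξ * (1 - t)) := rfl

/-- A positive linear functional on `C([0, 1])` is an integral against a finite measure. -/
lemma exists_finite_measure_of_positive (Λ : C(unitInterval, ℝ) →ₗ[ℝ] ℝ)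
    (hΛ : ∀ g : C(unitInterval, ℝ), (∀ t, 0 ≤ g t) → 0 ≤ Λ g) :
    ∃ ν : Measure unitInterval, IsFiniteMeasure ν ∧
      ∀ g : C(unitInterval, ℝ), Λ g = ∫ t, g t ∂ν := by
  let P : CompactlySupportedContinuousMap unitInterval ℝ →ₚ[ℝ] ℝ :=
    PositiveLinearMap.mk₀
      { toFun := fun f => Λ f.toContinuousMap
        map_add' := fun f g => Λ.map_add f.toContinuousMap g.toContinuousMap
        map_smul' := fun c f => Λ.map_smul c f.toContinuousMap }
      (fun f hf => hΛ _ fun t => hf t)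
  refine ⟨RealRMK.rieszMeasure P, ⟨?_⟩, fun g => ?_⟩
  · exact IsCompact.measure_lt_top isCompact_univ
  · exact (RealRMK.integral_rieszMeasure P
      (CompactlySupportedContinuousMap.continuousMapEquiv g)).symm

/-- A function represented by a positive functional on `C([0, 1])` evaluated at
`bernsteinKernel` is complete Bernstein. -/
lemma isCompleteBernstein_of_functional (Λ : C(unitInterval, ℝ) →ₗ[ℝ] ℝ)
    (hΛ : ∀ g : C(unitInterval, ℝ), (∀ t, 0 ≤ g t) → 0 ≤ Λ g) (ψ : ℝ → ℝ)
    (hψ : ∀ ξ (hξ : 0 < ξ), ψ ξ = Λ (bernsteinKernel ξ hξ)) : IsCompleteBernstein ψ := by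
  obtain ⟨ν, hν, hint⟩ := exists_finite_measure_of_positive Λ hΛ
  set S : Set unitInterval := {t | t ≠ 0 ∧ t ≠ 1} with hS
  have hSm : MeasurableSet S :=
    ((measurableSet_singleton 0).compl).inter ((measurableSet_singleton 1).compl)
  set w : unitInterval → ℝ≥0∞ := fun t => ENNReal.ofReal ((1 - (t : ℝ))⁻¹) with hw
  have hwm : Measurable w := by fun_prop
  set q : unitInterval → ℝ := fun t => (t : ℝ) / (1 - t) with hq
  have hqm : Measurable q := by fun_prop
  have hpos : ∀ t ∈ S, 0 < (t : ℝ) ∧ 0 < 1 - (t : ℝ) := by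
    rintro t ⟨h0, h1⟩
    exact ⟨unitInterval.pos_iff_ne_zero.2 h0, sub_pos.2 (unitInterval.lt_one_iff_ne_one.2 h1)⟩
  have hker : ∀ ξ, 0 < ξ → ∀ t ∈ S,
      (1 - (t : ℝ))⁻¹ * (ξ / (ξ + q t)) = ξ / (t + ξ * (1 - t)) := by
    intro ξ hξ t ht
    obtain ⟨h0, h1⟩ := hpos t ht
    have h2 : 0 < (t : ℝ) + ξ * (1 - t) := by positivity
    have h3 : 0 < ξ + q t := by simp only [hq]; positivity
    have h4 : ξ + q t = (t + ξ * (1 - t)) / (1 - t) := by simp only [hq]; field_simp; ring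
    rw [h4]; field_simp
  have hint' : ∀ ξ (hξ : 0 < ξ), Integrable (fun t => bernsteinKernel ξ hξ t) ν := fun ξ hξ =>
    (bernsteinKernel ξ hξ).continuous.integrable_of_hasCompactSupport
      (HasCompactSupport.of_compactSpace _)
  have hmeas : ∀ ξ : ℝ, Measurable fun s : ℝ => ξ / (ξ + s) := fun ξ => by fun_prop
  have hwS : ∀ ξ, 0 < ξ → ∀ t ∈ S, (w t).toReal • (ξ / (ξ + q t)) = ξ / (t + ξ * (1 - t)) := by
    intro ξ hξ t ht
    rw [hw]
    simp only [smul_eq_mul]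
    rw [ENNReal.toReal_ofReal (inv_nonneg.2 (hpos t ht).2.le), hker ξ hξ t ht]
  refine ⟨ν.real {0}, ν.real {1}, Measure.map q ((ν.restrict S).withDensity w),
    measureReal_nonneg, measureReal_nonneg, ?_, ?_, fun ξ hξ => ⟨?_, ?_⟩⟩
  · rw [Measure.map_apply hqm measurableSet_Iic, withDensity_apply _ (hqm measurableSet_Iic),
      Measure.restrict_restrict (hqm measurableSet_Iic)]
    have : q ⁻¹' Iic 0 ∩ S = ∅ := by
      ext t
      simp only [mem_inter_iff, mem_preimage, mem_Iic, mem_empty_iff_false, iff_false, not_and]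
      intro h ht
      exact absurd h (not_le.2 (div_pos (hpos t ht).1 (hpos t ht).2))
    simp [this]
  · rw [lintegral_map (by fun_prop) hqm, lintegral_withDensity_eq_lintegral_mul _ hwm
      (by fun_prop)]
    calc ∫⁻ t, (w * fun t => ENNReal.ofReal ((1 + q t)⁻¹)) t ∂(ν.restrict S)
        = ∫⁻ t, 1 ∂(ν.restrict S) := by
          refine setLIntegral_congr_fun hSm fun t ht => ?_
          have h := hker 1 one_pos t ht
          simp only [Pi.mul_apply, hw]
          rw [← ENNReal.ofReal_mul (inv_nonneg.2 (hpos t ht).2.le), ← one_div (1 + q t), h]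
          simp
      _ < ⊤ := by simp
  · rw [integrable_map_measure (hmeas ξ).aestronglyMeasurable hqm.aemeasurable,
      integrable_withDensity_iff_integrable_smul' hwm (by simp [hw])]
    exact ((hint' ξ hξ).integrableOn (s := S)).congr_fun
      (fun t ht => (hwS ξ hξ t ht).symm) hSm
  · rw [hψ ξ hξ, hint, integral_map hqm.aemeasurable (hmeas ξ).aestronglyMeasurable,
      integral_withDensity_eq_integral_toReal_smul hwm (by simp [hw]),
      setIntegral_congr_fun hSm (hwS ξ hξ)]
    have hcompl : Sᶜ = {0} ∪ {1} := by
      ext t; simp only [hS, mem_compl_iff, mem_ofPred_eq]; simp; tauto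
    rw [← integral_add_compl hSm (hint' ξ hξ), hcompl,
      setIntegral_union (by simp) (measurableSet_singleton _)
        (hint' ξ hξ).integrableOn (hint' ξ hξ).integrableOn]
    simp only [integral_singleton, bernsteinKernel_apply, smul_eq_mul]
    simp [hξ.ne']
    ring

/-- Pointwise limits of functions represented by positive functionals on `C([0, 1])` are
again represented by a positive functional. -/
lemma exists_functional_of_tendsto (Λ : ℕ → C(unitInterval, ℝ) →ₗ[ℝ] ℝ)
    (hΛ : ∀ n, ∀ g : C(unitInterval, ℝ), (∀ t, 0 ≤ g t) → 0 ≤ Λ n g) (ψ : ℝ → ℝ)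
    (hψ : ∀ ξ (hξ : 0 < ξ),
      Tendsto (fun n => Λ n (bernsteinKernel ξ hξ)) atTop (𝓝 (ψ ξ))) :
    ∃ Λ' : C(unitInterval, ℝ) →ₗ[ℝ] ℝ,
      (∀ g : C(unitInterval, ℝ), (∀ t, 0 ≤ g t) → 0 ≤ Λ' g) ∧
      ∀ ξ (hξ : 0 < ξ), ψ ξ = Λ' (bernsteinKernel ξ hξ) := by
  have hone : bernsteinKernel 1 one_pos = 1 := by
    ext t; simp [bernsteinKernel_apply]
  obtain ⟨C, hC⟩ : ∃ C, ∀ n, Λ n 1 ≤ C := by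
    obtain ⟨C, hC⟩ := (hψ 1 one_pos).bddAbove_range
    exact ⟨C, fun n => hone ▸ hC ⟨n, rfl⟩⟩
  have hbound : ∀ g n, Λ n g ∈ Icc (-(‖g‖ * C)) (‖g‖ * C) := by
    intro g n
    have h1 := hΛ n (‖g‖ • 1 - g) fun t => by
      have := (abs_le.1 (g.norm_coe_le_norm t)).2
      simpa using this
    have h2 := hΛ n (‖g‖ • 1 + g) fun t => by
      have := (abs_le.1 (g.norm_coe_le_norm t)).1
      simp; linarith
    have h3 := mul_le_mul_of_nonneg_left (hC n) (norm_nonneg g)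
    rw [map_sub, map_smul, smul_eq_mul] at h1
    rw [map_add, map_smul, smul_eq_mul] at h2
    constructor <;> linarith
  have hlim : ∀ g, ∃ l, Tendsto (fun n => Λ n g) (hyperfilter ℕ : Filter ℕ) (𝓝 l) := by
    intro g
    obtain ⟨l, -, hl⟩ := isCompact_Icc.ultrafilter_le_nhds
      ((hyperfilter ℕ).map fun n => Λ n g)
      (le_principal_iff.2 (Ultrafilter.mem_map.2 (Eventually.of_forall (hbound g))))
    exact ⟨l, hl⟩
  choose L hL using hlim
  refine ⟨{ toFun := L, map_add' := fun f g => ?_, map_smul' := fun c f => ?_ },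
    fun g hg => ?_, fun ξ hξ => ?_⟩
  · exact tendsto_nhds_unique (hL (f + g)) (by simpa using (hL f).add (hL g))
  · exact tendsto_nhds_unique (hL (c • f)) (by simpa using (hL f).const_mul c)
  · exact ge_of_tendsto' (hL g) fun n => hΛ n g hg
  · exact tendsto_nhds_unique ((hψ ξ hξ).mono_left Nat.hyperfilter_le_atTop) (hL _)

/-- The function `ξ ↦ ξ ⟨h, (1 + ξ K)⁻¹ h⟩`, for `K` a positive operator, is represented by
a positive functional on `C([0, 1])`. -/
lemma exists_functional_of_isPositive {H : Type*} [NormedAddCommGroup H]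
    [InnerProductSpace ℂ H] [CompleteSpace H] (K : H →L[ℂ] H) (hK : K.IsPositive) (h : H) :
    ∃ Λ : C(unitInterval, ℝ) →ₗ[ℝ] ℝ,
      (∀ g : C(unitInterval, ℝ), (∀ t, 0 ≤ g t) → 0 ≤ Λ g) ∧
      ∀ (ξ : ℝ) (hξ : 0 < ξ) (u : H), u + (ξ : ℂ) • K u = h →
        Λ (bernsteinKernel ξ hξ) = ξ * (inner ℂ h u).re := by
  have hK0 : 0 ≤ K := (ContinuousLinearMap.nonneg_iff_isPositive K).2 hK
  have hsa : IsSelfAdjoint K := hK.isSelfAdjoint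
  have hsp : ∀ s ∈ spectrum ℝ K, 0 ≤ s := fun s hs => spectrum_nonneg_of_nonneg hK0 hs
  set E : C(unitInterval, ℝ) → ℝ → ℝ := fun g s =>
    g (projIcc 0 1 zero_le_one (1 + s)⁻¹) * (1 + s)⁻¹ with hE
  have hcont1 : ContinuousOn (fun s : ℝ => (1 + s)⁻¹) (spectrum ℝ K) :=
    ContinuousOn.inv₀ (by fun_prop) fun s hs => by have := hsp s hs; positivity
  have hcont : ∀ g, ContinuousOn (E g) (spectrum ℝ K) := fun g =>
    ((g.continuous.comp continuous_projIcc).comp_continuousOn hcont1).mul hcont1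
  refine ⟨{ toFun := fun g => (inner ℂ h (cfc (E g) K h)).re
            map_add' := fun f g => ?_
            map_smul' := fun c f => ?_ }, fun g hg => ?_, fun ξ hξ u hu => ?_⟩
  · have : E (f + g) = fun s => E f s + E g s := by ext s; simp [hE]; ring
    rw [this, cfc_add K _ _ (hcont f) (hcont g)]
    simp
  · have : E (c • f) = fun s => c * E f s := by ext s; simp [hE]; ring
    rw [this, cfc_const_mul _ _ _ (hcont f)]
    simp [inner_smul_right_eq_smul]
  · have h0 : 0 ≤ cfc (E g) K := cfc_nonneg fun s hs => by
      have := hsp s hs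
      exact mul_nonneg (hg _) (by positivity)
    have := ((ContinuousLinearMap.nonneg_iff_isPositive _).1 h0).re_inner_nonneg_right h
    simpa using this
  · have hEξ : (spectrum ℝ K).EqOn (E (bernsteinKernel ξ hξ)) fun s => ξ * (1 + ξ * s)⁻¹ := by
      intro s hs
      have h0 := hsp s hs
      have hmem : (1 + s)⁻¹ ∈ Icc (0 : ℝ) 1 := ⟨by positivity, inv_le_one_of_one_le₀ (by linarith)⟩
      simp only [hE, bernsteinKernel_apply, projIcc_of_mem _ hmem]
      have h1 : 0 < 1 + s := by positivity
      have h2 : 0 < 1 + ξ * s := by positivity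
      have h3 : (1 + s)⁻¹ + ξ * (1 - (1 + s)⁻¹) = (1 + ξ * s) / (1 + s) := by field_simp; ring
      rw [h3]; field_simp
    have hc : ContinuousOn (fun s : ℝ => (1 + ξ * s)⁻¹) (spectrum ℝ K) :=
      ContinuousOn.inv₀ (by fun_prop) fun s hs => by have := hsp s hs; positivity
    have hc2 : ContinuousOn (fun s : ℝ => ξ * (1 + ξ * s)⁻¹) (spectrum ℝ K) := hc.const_smul ξ
    have hmul : cfc (fun s : ℝ => ξ * (1 + ξ * s)⁻¹) K * cfc (fun s : ℝ => 1 + ξ * s) K =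
        cfc (fun _ : ℝ => ξ) K := by
      rw [← cfc_mul _ _ K hc2 (by fun_prop)]
      refine cfc_congr fun s hs => ?_
      have := hsp s hs
      have h2 : 0 < 1 + ξ * s := by positivity
      field_simp
    have h1 : cfc (fun s : ℝ => 1 + ξ * s) K = 1 + ξ • K := by
      rw [cfc_const_add (1 : ℝ) (fun s => ξ * s) K, cfc_const_mul_id ξ K]
      simp
    have h2 : cfc (fun s : ℝ => ξ * (1 + ξ * s)⁻¹) K h = (ξ : ℂ) • u := by
      rw [h1, cfc_const ξ K] at hmul
      have hu' : (1 + ξ • K) u = h := by rw [← hu]; simp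
      have : cfc (fun s : ℝ => ξ * (1 + ξ * s)⁻¹) K ((1 + ξ • K) u) =
        (algebraMap ℝ (H →L[ℂ] H) ξ) u := congrArg (fun T : H →L[ℂ] H => T u) hmul
      rw [← hu', this]
      simp [Algebra.algebraMap_eq_smul_one]
    change (inner ℂ h (cfc (E (bernsteinKernel ξ hξ)) K h)).re = _
    rw [cfc_congr hEξ, h2, inner_smul_right]
    simp

/-- The measure `ξ f da` of `(0, t]`. -/
def stringSlope (a : Measure ℝ) (ξ : ℝ) (f : ℝ → ℝ) (t : ℝ) : ℝ := ξ * ∫ z in Ioc 0 t, f z ∂a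

/-- The iterated integral `∫₀ʸ ∫_{(0, t]} ξ f da dt`. -/
def stringVolterra (a : Measure ℝ) (ξ : ℝ) (f : ℝ → ℝ) (y : ℝ) : ℝ :=
  ∫ t in (0 : ℝ)..y, stringSlope a ξ f t

/-- The solution `∑ Tⁿ f` of the Volterra equation `u = f + T u` for `T = stringVolterra a ξ`. -/
def stringSol (a : Measure ℝ) (ξ : ℝ) (f : ℝ → ℝ) (y : ℝ) : ℝ :=
  ∑' n : ℕ, (stringVolterra a ξ)^[n] f y

section Volterra

variable {a : Measure ℝ} {ξ Y : ℝ} {f g : ℝ → ℝ}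

lemma measure_Ioc_ne_top (hY : a (Ioc 0 Y) ≠ ⊤) {t : ℝ} (ht : t ≤ Y) : a (Ioc 0 t) ≠ ⊤ :=
  measure_ne_top_of_subset (Ioc_subset_Ioc_right ht) hY

lemma integrableOn_Ioc_of_continuousOn (hY : a (Ioc 0 Y) ≠ ⊤) (hf : ContinuousOn f (Icc 0 Y))
    {t : ℝ} (ht : t ≤ Y) : IntegrableOn f (Ioc 0 t) a :=
  hf.integrableOn_of_subset_isCompact isCompact_Icc measurableSet_Ioc
    (Ioc_subset_Icc_self.trans (Icc_subset_Icc_right ht)) (measure_Ioc_ne_top hY ht)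

lemma exists_abs_le_of_continuousOn (hf : ContinuousOn f (Icc 0 Y)) :
    ∃ M, 0 ≤ M ∧ ∀ y ∈ Icc 0 Y, |f y| ≤ M := by
  obtain ⟨M, hM⟩ := isCompact_Icc.exists_bound_of_continuousOn hf
  exact ⟨max M 0, le_max_right _ _, fun y hy => (hM y hy).trans (le_max_left _ _)⟩

lemma abs_stringSlope_le (hξ : 0 ≤ ξ) (hY : a (Ioc 0 Y) ≠ ⊤) {t C : ℝ} (ht : t ≤ Y)
    (hC : ∀ z ∈ Ioc 0 t, |f z| ≤ C) (hC0 : 0 ≤ C) :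
    |stringSlope a ξ f t| ≤ ξ * (C * a.real (Ioc 0 Y)) := by
  rw [stringSlope, abs_mul, abs_of_nonneg hξ]
  have h1 := norm_setIntegral_le_of_norm_le_const (μ := a) (f := f)
    (measure_Ioc_ne_top hY ht).lt_top hC
  refine mul_le_mul_of_nonneg_left (h1.trans ?_) hξ
  exact mul_le_mul_of_nonneg_left (measureReal_mono (Ioc_subset_Ioc_right ht) hY) hC0

lemma stringSlope_sub (hY : a (Ioc 0 Y) ≠ ⊤) (hf : ContinuousOn f (Icc 0 Y))
    (hg : ContinuousOn g (Icc 0 Y)) {t : ℝ} (ht : t ≤ Y) :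
    stringSlope a ξ (fun y => f y - g y) t = stringSlope a ξ f t - stringSlope a ξ g t := by
  rw [stringSlope, integral_sub (integrableOn_Ioc_of_continuousOn hY hf ht)
    (integrableOn_Ioc_of_continuousOn hY hg ht), mul_sub]
  rfl

lemma stringSlope_const_mul (c t : ℝ) :
    stringSlope a ξ (fun y => c * f y) t = c * stringSlope a ξ f t := by
  rw [stringSlope, integral_const_mul, stringSlope]; ring

lemma stringSlope_sub_eq (hY : a (Ioc 0 Y) ≠ ⊤) (hf : ContinuousOn f (Icc 0 Y)) {s t : ℝ}
    (hs : 0 ≤ s) (hst : s ≤ t) (ht : t ≤ Y) :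
    stringSlope a ξ f t - stringSlope a ξ f s = ξ * ∫ z in Ioc s t, f z ∂a := by
  have hi := integrableOn_Ioc_of_continuousOn hY hf ht
  rw [stringSlope, stringSlope, ← mul_sub, ← Ioc_union_Ioc_eq_Ioc hs hst,
    setIntegral_union (Ioc_disjoint_Ioc_of_le le_rfl) measurableSet_Ioc
      (hi.mono_set (Ioc_subset_Ioc_right hst)) (hi.mono_set (Ioc_subset_Ioc_left hs))]
  ring

lemma stringSlope_monotoneOn (hξ : 0 ≤ ξ) (hY : a (Ioc 0 Y) ≠ ⊤) (hf : ContinuousOn f (Icc 0 Y))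
    (h0 : ∀ y ∈ Icc 0 Y, 0 ≤ f y) : MonotoneOn (stringSlope a ξ f) (Icc 0 Y) := by
  intro s hs t ht hst
  rw [← sub_nonneg, stringSlope_sub_eq hY hf hs.1 hst ht.2]
  refine mul_nonneg hξ (setIntegral_nonneg measurableSet_Ioc fun z hz => h0 z ?_)
  exact ⟨hs.1.trans hz.1.le, hz.2.trans ht.2⟩

lemma integrableOn_stringSlope (hξ : 0 ≤ ξ) (hY : a (Ioc 0 Y) ≠ ⊤)
    (hf : ContinuousOn f (Icc 0 Y)) : IntegrableOn (stringSlope a ξ f) (Icc 0 Y) := by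
  obtain ⟨M, hM0, hM⟩ := exists_abs_le_of_continuousOn hf
  have hfM : ContinuousOn (fun y => f y + M) (Icc 0 Y) := hf.add continuousOn_const
  have h1 := (stringSlope_monotoneOn hξ hY hfM fun y hy => by
    linarith [(abs_le.1 (hM y hy)).1]).integrableOn_isCompact (μ := volume) isCompact_Icc
  have h2 := (stringSlope_monotoneOn (f := fun _ => M) hξ hY continuousOn_const
    fun y _ => hM0).integrableOn_isCompact (μ := volume) isCompact_Icc
  refine (h1.sub h2).congr_fun (fun t ht => ?_) measurableSet_Icc
  have := stringSlope_sub (a := a) (ξ := ξ) hY hfM continuousOn_const ht.2 (g := fun _ => M)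
  simpa using this.symm

lemma intervalIntegrable_stringSlope (hξ : 0 ≤ ξ) (hY : a (Ioc 0 Y) ≠ ⊤)
    (hf : ContinuousOn f (Icc 0 Y)) {s t : ℝ} (hs : s ∈ Icc 0 Y) (ht : t ∈ Icc 0 Y) :
    IntervalIntegrable (stringSlope a ξ f) volume s t :=
  ((integrableOn_stringSlope hξ hY hf).mono_set
    ((convex_Icc 0 Y).ordConnected.uIcc_subset hs ht)).intervalIntegrable

lemma tendsto_stringSlope (hY : a (Ioc 0 Y) ≠ ⊤) (hf : ContinuousOn f (Icc 0 Y)) {y : ℝ}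
    (hyY : y < Y) :
    Tendsto (stringSlope a ξ f) (𝓝[>] y) (𝓝 (stringSlope a ξ f y)) := by
  have key : ∀ t ≤ Y, ∫ z in Ioc 0 t, f z ∂a =
      ∫ z, (Iic t).indicator f z ∂(a.restrict (Ioc 0 Y)) := by
    intro t ht
    rw [integral_indicator measurableSet_Iic, Measure.restrict_restrict measurableSet_Iic,
      inter_comm, Ioc_inter_Iic, inf_eq_right.2 ht]
  have hi : Integrable f (a.restrict (Ioc 0 Y)) := integrableOn_Ioc_of_continuousOn hY hf le_rfl
  refine Tendsto.const_mul ξ ?_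
  rw [key y hyY.le]
  have hev : ∀ᶠ t in 𝓝[>] y, t < Y := mem_nhdsWithin_of_mem_nhds (Iio_mem_nhds hyY)
  refine Tendsto.congr' (hev.mono fun t ht => (key t ht.le).symm) ?_
  refine tendsto_integral_filter_of_dominated_convergence (fun z => ‖f z‖)
    (Eventually.of_forall fun t => hi.aestronglyMeasurable.indicator measurableSet_Iic)
    (Eventually.of_forall fun t => Eventually.of_forall fun z => norm_indicator_le_norm_self _ _)
    hi.norm (Eventually.of_forall fun z => ?_)
  rcases le_or_gt z y with hz | hz
  · refine tendsto_const_nhds.congr' ?_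
    filter_upwards [self_mem_nhdsWithin] with t ht
    rw [indicator_of_mem (mem_Iic.2 hz), indicator_of_mem (mem_Iic.2 (hz.trans (le_of_lt ht)))]
  · refine tendsto_const_nhds.congr' ?_
    filter_upwards [mem_nhdsWithin_of_mem_nhds (Iio_mem_nhds hz)] with t ht
    rw [indicator_of_notMem (by simpa using hz), indicator_of_notMem (by simpa using ht)]

lemma stringVolterra_continuousOn (hξ : 0 ≤ ξ) (hY : a (Ioc 0 Y) ≠ ⊤)
    (hf : ContinuousOn f (Icc 0 Y)) : ContinuousOn (stringVolterra a ξ f) (Icc 0 Y) := by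
  rcases le_or_gt 0 Y with h | h
  · have := intervalIntegral.continuousOn_primitive_interval (a := 0) (b := Y)
      (by rw [uIcc_of_le h]; exact integrableOn_stringSlope hξ hY hf)
    rwa [uIcc_of_le h] at this
  · simp [Icc_eq_empty_of_lt h]

lemma stringVolterra_sub (hξ : 0 ≤ ξ) (hY : a (Ioc 0 Y) ≠ ⊤) (hf : ContinuousOn f (Icc 0 Y))
    (hg : ContinuousOn g (Icc 0 Y)) {y : ℝ} (hy : y ∈ Icc 0 Y) :
    stringVolterra a ξ (fun y => f y - g y) y =
      stringVolterra a ξ f y - stringVolterra a ξ g y := by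
  have h0 : (0 : ℝ) ∈ Icc 0 Y := ⟨le_rfl, hy.1.trans hy.2⟩
  rw [stringVolterra, stringVolterra, stringVolterra, ← intervalIntegral.integral_sub
    (intervalIntegrable_stringSlope hξ hY hf h0 hy)
    (intervalIntegrable_stringSlope hξ hY hg h0 hy)]
  refine intervalIntegral.integral_congr fun t ht => ?_
  rw [uIcc_of_le hy.1] at ht
  exact stringSlope_sub hY hf hg (ht.2.trans hy.2)

lemma stringVolterra_const_mul (c y : ℝ) :
    stringVolterra a ξ (fun y => c * f y) y = c * stringVolterra a ξ f y := by
  simp only [stringVolterra, stringSlope_const_mul, intervalIntegral.integral_const_mul]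

lemma stringVolterra_congr (h : ∀ y ∈ Icc 0 Y, f y = g y) {y : ℝ} (hy : y ∈ Icc 0 Y) :
    stringVolterra a ξ f y = stringVolterra a ξ g y := by
  refine intervalIntegral.integral_congr fun t ht => ?_
  rw [uIcc_of_le hy.1] at ht
  simp only [stringSlope]
  rw [setIntegral_congr_fun measurableSet_Ioc fun z hz =>
    h z ⟨hz.1.le, hz.2.trans (ht.2.trans hy.2)⟩]

lemma stringVolterra_nonneg (hξ : 0 ≤ ξ) (h0 : ∀ y ∈ Icc 0 Y, 0 ≤ f y) {y : ℝ}
    (hy : y ∈ Icc 0 Y) : 0 ≤ stringVolterra a ξ f y :=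
  intervalIntegral.integral_nonneg hy.1 fun _ ht => mul_nonneg hξ <|
    setIntegral_nonneg measurableSet_Ioc fun z hz =>
      h0 z ⟨hz.1.le, hz.2.trans (ht.2.trans hy.2)⟩

lemma abs_stringVolterra_le (hξ : 0 ≤ ξ) (hY : a (Ioc 0 Y) ≠ ⊤) {C : ℝ} (hC : 0 ≤ C) {n : ℕ}
    (hf : ∀ z ∈ Icc 0 Y, |f z| ≤ C * z ^ n) {y : ℝ} (hy : y ∈ Icc 0 Y) :
    |stringVolterra a ξ f y| ≤ C * (ξ * a.real (Ioc 0 Y)) / (n + 1) * y ^ (n + 1) := by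
  have hb : ∀ t ∈ Ioc 0 y, ‖stringSlope a ξ f t‖ ≤ C * (ξ * a.real (Ioc 0 Y)) * t ^ n := by
    intro t ht
    have htY := ht.2.trans hy.2
    have := abs_stringSlope_le (a := a) (f := f) hξ hY htY (C := C * t ^ n) (fun z hz =>
      (hf z ⟨hz.1.le, hz.2.trans htY⟩).trans
        (mul_le_mul_of_nonneg_left (pow_le_pow_left₀ hz.1.le hz.2 n) hC))
      (mul_nonneg hC (pow_nonneg ht.1.le n))
    rw [Real.norm_eq_abs]
    linarith
  have := intervalIntegral.norm_integral_le_of_norm_le (μ := volume) hy.1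
    (Eventually.of_forall hb) ((continuous_const.mul (continuous_pow n)).intervalIntegrable _ _)
  rw [intervalIntegral.integral_const_mul, integral_pow] at this
  refine this.trans (le_of_eq ?_)
  simp; ring

lemma stringVolterra_iterate_spec (hξ : 0 ≤ ξ) (hY : a (Ioc 0 Y) ≠ ⊤)
    (hf : ContinuousOn f (Icc 0 Y)) {M : ℝ} (hM0 : 0 ≤ M) (hM : ∀ y ∈ Icc 0 Y, |f y| ≤ M) (n : ℕ) :
    ContinuousOn ((stringVolterra a ξ)^[n] f) (Icc 0 Y) ∧ ∀ y ∈ Icc 0 Y,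
      |(stringVolterra a ξ)^[n] f y| ≤ M * ((ξ * a.real (Ioc 0 Y)) ^ n / n.factorial) * y ^ n := by
  induction n with
  | zero => exact ⟨hf, fun y hy => by simpa using hM y hy⟩
  | succ n ih =>
    rw [Function.iterate_succ_apply']
    refine ⟨stringVolterra_continuousOn hξ hY ih.1, fun y hy => ?_⟩
    refine (abs_stringVolterra_le hξ hY (by positivity) ih.2 hy).trans (le_of_eq ?_)
    rw [Nat.factorial_succ]
    push_cast
    field_simp
    ring

lemma abs_stringVolterra_iterate_le (hξ : 0 ≤ ξ) (hY : a (Ioc 0 Y) ≠ ⊤)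
    (hf : ContinuousOn f (Icc 0 Y)) {M : ℝ} (hM0 : 0 ≤ M) (hM : ∀ y ∈ Icc 0 Y, |f y| ≤ M) (n : ℕ)
    {y : ℝ} (hy : y ∈ Icc 0 Y) :
    |(stringVolterra a ξ)^[n] f y| ≤ M * ((ξ * a.real (Ioc 0 Y) * Y) ^ n / n.factorial) := by
  refine ((stringVolterra_iterate_spec hξ hY hf hM0 hM n).2 y hy).trans ?_
  have : y ^ n ≤ Y ^ n := pow_le_pow_left₀ hy.1 hy.2 n
  calc _ ≤ M * ((ξ * a.real (Ioc 0 Y)) ^ n / n.factorial) * Y ^ n := by gcongr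
    _ = _ := by rw [mul_pow]; ring

/-- The homogeneous Volterra equation has only the trivial solution. -/
lemma eq_zero_of_eq_stringVolterra (hξ : 0 ≤ ξ) (hY : a (Ioc 0 Y) ≠ ⊤)
    (hf : ContinuousOn f (Icc 0 Y)) (h : ∀ y ∈ Icc 0 Y, f y = stringVolterra a ξ f y) {y : ℝ}
    (hy : y ∈ Icc 0 Y) : f y = 0 := by
  obtain ⟨M, hM0, hM⟩ := exists_abs_le_of_continuousOn hf
  have hit : ∀ n, ∀ y ∈ Icc 0 Y, (stringVolterra a ξ)^[n] f y = f y := by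
    intro n
    induction n with
    | zero => simp
    | succ n ih =>
      intro y hy
      rw [Function.iterate_succ_apply', stringVolterra_congr ih hy, ← h y hy]
  have h1 : ∀ n, |f y| ≤ M * ((ξ * a.real (Ioc 0 Y) * Y) ^ n / n.factorial) := fun n => by
    rw [← hit n y hy]
    exact abs_stringVolterra_iterate_le hξ hY hf hM0 hM n hy
  have h2 := ge_of_tendsto'
    ((FloorSemiring.tendsto_pow_div_factorial_atTop (ξ * a.real (Ioc 0 Y) * Y)).const_mul M) h1
  rw [mul_zero] at h2
  exact abs_nonpos_iff.1 h2

lemma stringSol_spec (hξ : 0 ≤ ξ) (hY : a (Ioc 0 Y) ≠ ⊤) (hf : ContinuousOn f (Icc 0 Y)) :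
    ContinuousOn (stringSol a ξ f) (Icc 0 Y) ∧
      ∀ y ∈ Icc 0 Y, stringSol a ξ f y = f y + stringVolterra a ξ (stringSol a ξ f) y := by
  obtain ⟨M, hM0, hM⟩ := exists_abs_le_of_continuousOn hf
  have hsum : Summable fun n : ℕ => M * ((ξ * a.real (Ioc 0 Y) * Y) ^ n / n.factorial) :=
    (Real.summable_pow_div_factorial _).mul_left M
  have hc := fun n => (stringVolterra_iterate_spec hξ hY hf hM0 hM n).1
  have hb : ∀ (n : ℕ), ∀ y ∈ Icc 0 Y, ‖(stringVolterra a ξ)^[n] f y‖ ≤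
      M * ((ξ * a.real (Ioc 0 Y) * Y) ^ n / n.factorial) := fun n y hy =>
    abs_stringVolterra_iterate_le hξ hY hf hM0 hM n hy
  have hcont : ContinuousOn (stringSol a ξ f) (Icc 0 Y) := continuousOn_tsum hc hsum hb
  refine ⟨hcont, fun y hy => ?_⟩
  set S : ℕ → ℝ → ℝ := fun N y => ∑ n ∈ Finset.range N, (stringVolterra a ξ)^[n] f y with hS
  have hSc : ∀ N, ContinuousOn (S N) (Icc 0 Y) := fun N => continuousOn_finsetSum _ fun n _ => hc n
  have hunif : TendstoUniformlyOn S (stringSol a ξ f) atTop (Icc 0 Y) :=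
    tendstoUniformlyOn_tsum_nat hsum hb
  have hstep : ∀ N, ∀ y ∈ Icc 0 Y, S (N + 1) y = f y + stringVolterra a ξ (S N) y := by
    intro N
    induction N with
    | zero => intro y _; simp [hS, stringVolterra, stringSlope]
    | succ N ih =>
      intro y hy
      have h1 : (fun z => S (N + 1) z - S N z) = (stringVolterra a ξ)^[N] f := by
        ext z; simp [hS, Finset.sum_range_succ]
      have h2 := stringVolterra_sub hξ hY (hSc (N + 1)) (hSc N) hy
      rw [h1, ← Function.iterate_succ_apply' (stringVolterra a ξ)] at h2
      have h3 : S (N + 1 + 1) y = S (N + 1) y + (stringVolterra a ξ)^[N + 1] f y := by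
        simp only [hS]; rw [Finset.sum_range_succ]
      rw [h3, h2, ih y hy]; ring
  have hlim : Tendsto (fun N => stringVolterra a ξ (S N) y) atTop
      (𝓝 (stringVolterra a ξ (stringSol a ξ f) y)) := by
    rw [Metric.tendsto_atTop]
    intro ε hε
    set B := ξ * a.real (Ioc 0 Y) * y with hB
    have hB0 : 0 ≤ B := mul_nonneg (by positivity) hy.1
    obtain ⟨N₀, hN₀⟩ := eventually_atTop.1 (Metric.tendstoUniformlyOn_iff.1 hunif (ε / (B + 1))
      (by positivity))
    refine ⟨N₀, fun N hN => ?_⟩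
    rw [Real.dist_eq, ← stringVolterra_sub hξ hY (hSc N) hcont hy]
    have := abs_stringVolterra_le (a := a) (f := fun y => S N y - stringSol a ξ f y) (n := 0)
      hξ hY (C := ε / (B + 1)) (by positivity) (fun z hz => by
        have := (hN₀ N hN z hz).le
        rw [dist_comm, Real.dist_eq] at this
        simpa using this) hy
    refine this.trans_lt ?_
    have h1 : ε / (B + 1) * (ξ * a.real (Ioc 0 Y)) / ((0 : ℕ) + 1) * y ^ (0 + 1) =
        ε * (B / (B + 1)) := by rw [hB]; simp; ring
    rw [h1]
    exact mul_lt_of_lt_one_right hε ((div_lt_one (by positivity)).2 (by linarith))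
  exact tendsto_nhds_unique ((tendsto_add_atTop_iff_nat 1).2 (hunif.tendsto_at hy))
    ((hlim.const_add (f y)).congr fun N => (hstep N y hy).symm)

lemma le_stringSol (hξ : 0 ≤ ξ) (hY : a (Ioc 0 Y) ≠ ⊤) (hf : ContinuousOn f (Icc 0 Y))
    (h0 : ∀ y ∈ Icc 0 Y, 0 ≤ f y) {y : ℝ} (hy : y ∈ Icc 0 Y) : f y ≤ stringSol a ξ f y := by
  have hit : ∀ n, ∀ y ∈ Icc 0 Y, 0 ≤ (stringVolterra a ξ)^[n] f y := by
    intro n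
    induction n with
    | zero => simpa using h0
    | succ n ih =>
      intro y hy
      rw [Function.iterate_succ_apply']
      exact stringVolterra_nonneg hξ ih hy
  obtain ⟨M, hM0, hM⟩ := exists_abs_le_of_continuousOn hf
  have hsum : Summable fun n : ℕ => (stringVolterra a ξ)^[n] f y :=
    .of_norm_bounded ((Real.summable_pow_div_factorial _).mul_left M) fun n =>
      abs_stringVolterra_iterate_le hξ hY hf hM0 hM n hy
  exact hsum.le_tsum 0 fun n _ => hit n y hy

end Volterra

section Truncated

variable {a : Measure ℝ} {ξ N p : ℝ} {φ : ℝ → ℝ}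

lemma sub_eq_integral_of_eq_stringVolterra (hξ : 0 ≤ ξ) (hN : a (Ioc 0 N) ≠ ⊤)
    (hφ : ContinuousOn φ (Icc 0 N)) (heq : ∀ y ∈ Icc 0 N, φ y = 1 - p * y + stringVolterra a ξ φ y)
    {s t : ℝ} (hs : s ∈ Icc 0 N) (ht : t ∈ Icc 0 N) :
    φ t - φ s = ∫ x in s..t, (stringSlope a ξ φ x - p) := by
  have h0 : (0 : ℝ) ∈ Icc 0 N := ⟨le_rfl, hs.1.trans hs.2⟩
  have hi := fun {s t} hs ht => intervalIntegrable_stringSlope (s := s) (t := t) hξ hN hφ hs ht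
  rw [heq t ht, heq s hs, intervalIntegral.integral_sub (hi hs ht) (by simp),
    stringVolterra, stringVolterra,
    ← intervalIntegral.integral_add_adjacent_intervals (hi h0 hs) (hi hs ht)]
  simp
  ring

lemma nonneg_of_eq_stringVolterra (hξ : 0 ≤ ξ) (hN : a (Ioc 0 N) ≠ ⊤)
    (hφ : ContinuousOn φ (Icc 0 N)) (heq : ∀ y ∈ Icc 0 N, φ y = 1 - p * y + stringVolterra a ξ φ y)
    (hφN : φ N = 0) : ∀ y ∈ Icc 0 N, 0 ≤ φ y := by
  have hdiff := fun {s t} hs ht =>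
    sub_eq_integral_of_eq_stringVolterra (s := s) (t := t) hξ hN hφ heq hs ht
  have hii : ∀ {s t}, s ∈ Icc 0 N → t ∈ Icc 0 N →
      IntervalIntegrable (fun x => stringSlope a ξ φ x - p) volume s t := fun hs ht =>
    (intervalIntegrable_stringSlope hξ hN hφ hs ht).sub (by simp)
  have persist : ∀ t ∈ Icc 0 N, φ t < 0 → ¬ stringSlope a ξ φ t - p < 0 := by
    intro t ht hφt hvt
    have hsub : Icc t N ⊆ Icc 0 N := Icc_subset_Icc_left ht.1
    have hZ : IsCompact (Icc t N ∩ φ ⁻¹' Ici 0) :=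
      isCompact_Icc.of_isClosed_subset ((hφ.mono hsub).preimage_isClosed_of_isClosed
        isClosed_Icc isClosed_Ici) inter_subset_left
    obtain ⟨s, ⟨hs, hφs⟩, hleast⟩ := hZ.exists_isLeast ⟨N, ⟨ht.2, le_rfl⟩, by simp [hφN]⟩
    have hneg : ∀ x, t ≤ x → x < s → φ x < 0 := fun x hx hxs => by
      by_contra! h
      exact absurd (hleast ⟨⟨hx, hxs.le.trans hs.2⟩, h⟩) (not_le.2 hxs)
    have hv : ∀ x ∈ Ioo t s, stringSlope a ξ φ x - p ≤ 0 := by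
      intro x hx
      have h1 := stringSlope_sub_eq (ξ := ξ) hN hφ ht.1 hx.1.le (hx.2.le.trans hs.2)
      have h2 : ∫ z in Ioc t x, φ z ∂a ≤ 0 := setIntegral_nonpos measurableSet_Ioc fun z hz =>
        (hneg z hz.1.le (hz.2.trans_lt hx.2)).le
      have h3 := mul_nonpos_of_nonneg_of_nonpos hξ h2
      linarith
    have h1 := hdiff ht (hsub hs)
    have h2 := intervalIntegral.integral_mono_on_of_le_Ioo (μ := volume) hs.1
      (hii ht (hsub hs)) (g := fun _ => 0) (by simp) hv
    rw [← h1] at h2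
    simp only [intervalIntegral.integral_zero] at h2
    have : 0 ≤ φ s := hφs
    linarith
  intro y hy
  by_contra! hneg
  have hsub : Icc 0 y ⊆ Icc 0 N := Icc_subset_Icc_right hy.2
  have hZ : IsCompact (Icc 0 y ∩ φ ⁻¹' Ici 0) :=
    isCompact_Icc.of_isClosed_subset ((hφ.mono hsub).preimage_isClosed_of_isClosed
      isClosed_Icc isClosed_Ici) inter_subset_left
  have h0 : φ 0 = 1 := by
    rw [heq 0 ⟨le_rfl, hy.1.trans hy.2⟩]; simp [stringVolterra]
  obtain ⟨s, ⟨hs, hφs⟩, hgreatest⟩ := hZ.exists_isGreatest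
    ⟨0, ⟨le_rfl, hy.1⟩, by simp [h0]⟩
  have hφs' : 0 ≤ φ s := hφs
  have hv : ∀ x ∈ Ioo s y, 0 ≤ stringSlope a ξ φ x - p := by
    intro x hx
    have hx0 : x ∈ Icc 0 y := ⟨hs.1.trans hx.1.le, hx.2.le⟩
    refine not_lt.1 (persist x (hsub hx0) ?_)
    by_contra! h
    exact absurd (hgreatest ⟨hx0, h⟩) (not_le.2 hx.1)
  have h2 := intervalIntegral.integral_mono_on_of_le_Ioo (μ := volume) hs.2
    (f := fun _ => 0) (by simp) (hii (hsub hs) hy) hv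
  rw [← hdiff (hsub hs) hy, intervalIntegral.integral_zero] at h2
  linarith

lemma mul_le_of_eq_stringVolterra (hξ : 0 ≤ ξ) (hN : a (Ioc 0 N) ≠ ⊤)
    (hφ : ContinuousOn φ (Icc 0 N)) (heq : ∀ y ∈ Icc 0 N, φ y = 1 - p * y + stringVolterra a ξ φ y)
    (hφN : φ N = 0) {y : ℝ} (hy : y ∈ Icc 0 N) : N * φ y ≤ N - y := by
  have hmono := stringSlope_monotoneOn hξ hN hφ (nonneg_of_eq_stringVolterra hξ hN hφ heq hφN)
  have hdiff := fun {s t} hs ht =>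
    sub_eq_integral_of_eq_stringVolterra (s := s) (t := t) hξ hN hφ heq hs ht
  have hii : ∀ {s t}, s ∈ Icc 0 N → t ∈ Icc 0 N →
      IntervalIntegrable (fun x => stringSlope a ξ φ x - p) volume s t := fun hs ht =>
    (intervalIntegrable_stringSlope hξ hN hφ hs ht).sub (by simp)
  have h0N : (0 : ℝ) ∈ Icc 0 N := ⟨le_rfl, hy.1.trans hy.2⟩
  have hNN : N ∈ Icc 0 N := ⟨hy.1.trans hy.2, le_rfl⟩
  have h0 : φ 0 = 1 := by
    rw [heq 0 h0N]; simp [stringVolterra]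
  have h1 := intervalIntegral.integral_mono_on (μ := volume) hy.1 (hii h0N hy)
    (g := fun _ => stringSlope a ξ φ y - p) (by simp) fun x hx =>
      sub_le_sub_right (hmono ⟨hx.1, hx.2.trans hy.2⟩ hy hx.2) p
  have h2 := intervalIntegral.integral_mono_on (μ := volume) hy.2
    (f := fun _ => stringSlope a ξ φ y - p) (by simp) (hii hy hNN) fun x hx =>
      sub_le_sub_right (hmono hy ⟨hy.1.trans hx.1, hx.2⟩ hx.1) p
  rw [← hdiff h0N hy, intervalIntegral.integral_const, smul_eq_mul, h0] at h1
  rw [← hdiff hy hNN, intervalIntegral.integral_const, smul_eq_mul, hφN] at h2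
  have h3 := mul_le_mul_of_nonneg_left h1 (sub_nonneg.2 hy.2)
  have h4 := mul_le_mul_of_nonneg_left h2 hy.1
  nlinarith

end Truncated

/-- Fubini's theorem on the triangle `0 < z ≤ t ≤ N`. -/
lemma integral_smul_integral_Ioc {E : Type*} [NormedAddCommGroup E] [NormedSpace ℝ E]
    [CompleteSpace E] {a : Measure ℝ} {N : ℝ} (hN : a (Ioc 0 N) ≠ ⊤) {φ : ℝ → ℝ} {g : ℝ → E}
    (hφ : IntegrableOn φ (Ioc 0 N) a) (hg : IntegrableOn g (Ioc 0 N)) :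
    ∫ t in Ioc 0 N, (∫ z in Ioc 0 t, φ z ∂a) • g t =
      ∫ z in Ioc 0 N, φ z • (∫ t in Ioc z N, g t) ∂a := by
  have : IsFiniteMeasure (a.restrict (Ioc 0 N)) := ⟨by simpa using hN.lt_top⟩
  set F : ℝ → ℝ → E := fun t z => {q : ℝ × ℝ | q.2 ≤ q.1}.indicator (fun q => φ q.2 • g q.1) (t, z)
    with hF
  have hint : Integrable (Function.uncurry F)
      ((volume.restrict (Ioc 0 N)).prod (a.restrict (Ioc 0 N))) := by
    refine Integrable.indicator ?_ (measurableSet_le measurable_snd measurable_fst)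
    exact (Integrable.smul_prod (f := φ) (g := g) hφ hg).swap
  have hswap := integral_integral_swap hint
  have h1 : ∀ t ∈ Ioc 0 N, ∫ z in Ioc 0 N, F t z ∂a = (∫ z in Ioc 0 t, φ z ∂a) • g t := by
    intro t ht
    have : F t = (Iic t).indicator fun z => φ z • g t := by
      ext z; by_cases h : z ≤ t <;> simp [hF, h]
    rw [this, setIntegral_indicator measurableSet_Iic, Ioc_inter_Iic, inf_eq_right.2 ht.2,
      integral_smul_const]
  have h2 : ∀ z ∈ Ioc 0 N, ∫ t in Ioc 0 N, F t z = φ z • ∫ t in Ioc z N, g t := by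
    intro z hz
    have : (fun t => F t z) = (Ici z).indicator fun t => φ z • g t := by
      ext t; by_cases h : z ≤ t <;> simp [hF, h]
    have hset : Ioc 0 N ∩ Ici z = Icc z N := by
      ext t
      simp only [mem_inter_iff, mem_Ioc, mem_Ici, mem_Icc]
      exact ⟨fun h => ⟨h.2, h.1.2⟩, fun h => ⟨⟨hz.1.trans_le h.1, h.2⟩, h.1⟩⟩
    rw [this, setIntegral_indicator measurableSet_Ici, hset, integral_Icc_eq_integral_Ioc,
      integral_smul]
  rw [← setIntegral_congr_fun measurableSet_Ioc h1, ← setIntegral_congr_fun measurableSet_Ioc h2]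
  exact hswap

/-- The adjoint factor of the Green operator of `-d²/dy²` on `(0, N)` with Dirichlet conditions. -/
lemma exists_dirichlet_primitive {a : Measure ℝ} {N : ℝ} (hN0 : 0 < N) (hN : a (Ioc 0 N) ≠ ⊤) :
    ∃ T : Lp ℂ 2 (volume.restrict (Ioc 0 N)) →L[ℂ] Lp ℂ 2 (a.restrict (Ioc 0 N)),
      ∀ g, T g =ᵐ[a.restrict (Ioc 0 N)] fun y =>
        (∫ t in Ioc 0 y, g t) - ((y / N : ℝ) : ℂ) * ∫ t in Ioc 0 N, g t := by
  have : IsFiniteMeasure (a.restrict (Ioc 0 N)) := ⟨by simpa using hN.lt_top⟩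
  set lam : Measure ℝ := volume.restrict (Ioc 0 N) with hlam
  set G : Lp ℂ 2 lam → ℝ → ℂ := fun g y =>
    (∫ t in (0 : ℝ)..y, g t ∂lam) - ((y / N : ℝ) : ℂ) * ∫ t, g t ∂lam with hG
  have hint : ∀ g : Lp ℂ 2 lam, Integrable g lam := fun g => (Lp.memLp g).integrable one_le_two
  have hcont : ∀ g, Continuous (G g) := fun g =>
    (intervalIntegral.continuous_primitive (fun s t => (hint g).intervalIntegrable) 0).sub
      (by fun_prop)
  set C : ℝ := (lam univ ^ (1 / (1 : ℝ≥0∞).toReal - 1 / (2 : ℝ≥0∞).toReal)).toReal with hC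
  have hnorm : ∀ g : Lp ℂ 2 lam, ∫ t, ‖g t‖ ∂lam ≤ ‖g‖ * C := by
    intro g
    have h := eLpNorm_le_eLpNorm_mul_rpow_measure_univ (μ := lam) (f := g) (p := 1) (q := 2)
      one_le_two (Lp.aestronglyMeasurable g)
    rw [integral_norm_eq_lintegral_enorm (Lp.aestronglyMeasurable g),
      ← eLpNorm_one_eq_lintegral_enorm, Lp.norm_def, hC, ← ENNReal.toReal_mul]
    refine ENNReal.toReal_mono (ENNReal.mul_ne_top (Lp.eLpNorm_ne_top g) ?_) h
    refine ENNReal.rpow_ne_top_of_nonneg (by norm_num) (by simp [hlam])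
  have hb1 : ∀ (g : Lp ℂ 2 lam) (s : Set ℝ), ‖∫ t in s, g t ∂lam‖ ≤ ‖g‖ * C := fun g s =>
    (norm_integral_le_integral_norm _).trans <|
      (setIntegral_le_integral (hint g).norm (ae_of_all _ fun _ => norm_nonneg _)).trans (hnorm g)
  have hbound : ∀ g : Lp ℂ 2 lam, ∀ᵐ y ∂a.restrict (Ioc 0 N), ‖G g y‖ ≤ 2 * (‖g‖ * C) := by
    intro g
    filter_upwards [ae_restrict_mem measurableSet_Ioc] with y hy
    have h1 : ‖∫ t in (0 : ℝ)..y, g t ∂lam‖ ≤ ‖g‖ * C := by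
      rw [intervalIntegral.integral_of_le hy.1.le]
      exact hb1 g _
    have h2 : ‖((y / N : ℝ) : ℂ) * ∫ t, g t ∂lam‖ ≤ ‖g‖ * C := by
      have h3 : ‖((y / N : ℝ) : ℂ)‖ ≤ 1 := by
        rw [Complex.norm_real, Real.norm_of_nonneg (div_nonneg hy.1.le hN0.le)]
        exact (div_le_one hN0).2 hy.2
      have h4 := hb1 g univ
      rw [Measure.restrict_univ] at h4
      rw [norm_mul]
      exact (mul_le_of_le_one_left (norm_nonneg _) h3).trans h4
    exact (norm_sub_le _ _).trans (by linarith)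
  have hmem : ∀ g, MemLp (G g) 2 (a.restrict (Ioc 0 N)) := fun g =>
    MemLp.of_bound (hcont g).aestronglyMeasurable _ (hbound g)
  let T₀ : Lp ℂ 2 lam →ₗ[ℂ] Lp ℂ 2 (a.restrict (Ioc 0 N)) :=
    { toFun := fun g => (hmem g).toLp (G g)
      map_add' := fun f g => by
        rw [← MemLp.toLp_add]
        refine MemLp.toLp_congr _ _ (ae_of_all _ fun y => ?_)
        have h := Lp.coeFn_add f g
        simp only [hG, Pi.add_apply]
        rw [integral_congr_ae h, intervalIntegral.integral_congr_ae
          (h.mono fun x hx _ => hx)]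
        simp only [Pi.add_apply]
        rw [integral_add (hint f) (hint g), intervalIntegral.integral_add
          (hint f).intervalIntegrable (hint g).intervalIntegrable]
        ring
      map_smul' := fun c f => by
        rw [RingHom.id_apply, ← MemLp.toLp_const_smul]
        refine MemLp.toLp_congr _ _ (ae_of_all _ fun y => ?_)
        have h := Lp.coeFn_smul c f
        simp only [hG, Pi.smul_apply]
        rw [integral_congr_ae h, intervalIntegral.integral_congr_ae
          (h.mono fun x hx _ => hx)]
        simp only [Pi.smul_apply]
        rw [integral_smul, intervalIntegral.integral_smul]
        simp only [smul_eq_mul]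
        ring }
  have hT₀ : ∀ g, ‖T₀ g‖ ≤ ((measureUnivNNReal (a.restrict (Ioc 0 N)) : ℝ) ^
      ((2 : ℝ≥0∞).toReal⁻¹) * (2 * C)) * ‖g‖ := by
    intro g
    have hC0 : 0 ≤ C := ENNReal.toReal_nonneg
    have h := Lp.norm_le_of_ae_bound (f := T₀ g) (C := 2 * (‖g‖ * C)) (by positivity) (by
      filter_upwards [(hmem g).coeFn_toLp, hbound g] with y h1 h2
      change ‖(hmem g).toLp (G g) y‖ ≤ _
      rwa [h1])
    refine h.trans (le_of_eq ?_)
    ring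
  refine ⟨T₀.mkContinuous _ hT₀, fun g => ?_⟩
  filter_upwards [(hmem g).coeFn_toLp, ae_restrict_mem measurableSet_Ioc] with y h1 hy
  refine h1.trans ?_
  simp only [hG, hlam]
  rw [intervalIntegral.integral_of_le hy.1.le, Measure.restrict_restrict measurableSet_Ioc,
    Ioc_inter_Ioc, sup_idem, inf_eq_left.2 hy.2]

lemma setIntegral_stringSlope_mul {a : Measure ℝ} {ξ N : ℝ} {φ : ℝ → ℝ} {g : ℝ → ℂ}
    (hN : a (Ioc 0 N) ≠ ⊤) (hφ : ContinuousOn φ (Icc 0 N)) (hg : IntegrableOn g (Ioc 0 N)) :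
    ∫ t in Ioc 0 N, (stringSlope a ξ φ t : ℂ) * g t =
      ξ * ∫ z in Ioc 0 N, φ z * ((∫ t in Ioc 0 N, g t) - ∫ t in Ioc 0 z, g t) ∂a := by
  have h := integral_smul_integral_Ioc hN (integrableOn_Ioc_of_continuousOn hN hφ le_rfl) hg
  simp only [Complex.real_smul] at h
  have h1 : ∀ z ∈ Ioc 0 N, (φ z : ℂ) * ∫ t in Ioc z N, g t =
      φ z * ((∫ t in Ioc 0 N, g t) - ∫ t in Ioc 0 z, g t) := by
    intro z hz
    rw [← Ioc_union_Ioc_eq_Ioc hz.1.le hz.2, setIntegral_union (Ioc_disjoint_Ioc_of_le le_rfl)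
      measurableSet_Ioc (hg.mono_set (Ioc_subset_Ioc_right hz.2))
      (hg.mono_set (Ioc_subset_Ioc_left hz.1.le)), add_sub_cancel_left]
  rw [← setIntegral_congr_fun measurableSet_Ioc h1, ← h, ← integral_const_mul]
  refine integral_congr_ae (ae_of_all _ fun t => ?_)
  simp only [stringSlope, Complex.ofReal_mul]
  ring

section Truncated

variable {a : Measure ℝ} {ξ N p : ℝ} {φ : ℝ → ℝ}

lemma sub_inv_eq_of_eq_stringVolterra (hN0 : 0 < N) (hN : a (Ioc 0 N) ≠ ⊤)
    (hφ : ContinuousOn φ (Icc 0 N)) (heq : ∀ y ∈ Icc 0 N, φ y = 1 - p * y + stringVolterra a ξ φ y)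
    (hφN : φ N = 0) : p - 1 / N = ξ * ∫ z in Ioc 0 N, φ z * (1 - z / N) ∂a := by
  have h := setIntegral_stringSlope_mul (ξ := ξ) (g := fun _ => 1) hN hφ (by simp)
  have h1 : ∀ z ∈ Ioc 0 N, (φ z : ℂ) * ((∫ t in Ioc 0 N, (1 : ℂ)) - ∫ t in Ioc 0 z, (1 : ℂ)) =
      ((N * (φ z * (1 - z / N)) : ℝ) : ℂ) := by
    intro z hz
    have : (N : ℂ) ≠ 0 := by exact_mod_cast hN0.ne'
    simp [hN0.le, hz.1.le]
    field_simp
  rw [setIntegral_congr_fun measurableSet_Ioc h1, integral_complex_ofReal, integral_const_mul] at h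
  simp only [mul_one] at h
  rw [integral_complex_ofReal, ← intervalIntegral.integral_of_le hN0.le] at h
  have h2 := heq N ⟨hN0.le, le_rfl⟩
  rw [hφN, stringVolterra] at h2
  have h3 : ∫ t in (0 : ℝ)..N, stringSlope a ξ φ t =
      ξ * (N * ∫ z in Ioc 0 N, φ z * (1 - z / N) ∂a) := by exact_mod_cast h
  rw [h3] at h2
  generalize ∫ z in Ioc 0 N, φ z * (1 - z / N) ∂a = J at h2 ⊢
  field_simp
  linarith

/-- The truncated problems on `[0, N]` are solved by one spectral measure, uniformly in `ξ`. -/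
lemma exists_functional_truncated (hN0 : 0 < N) (hN : a (Ioc 0 N) ≠ ⊤) :
    ∃ Λ : C(unitInterval, ℝ) →ₗ[ℝ] ℝ,
      (∀ g : C(unitInterval, ℝ), (∀ t, 0 ≤ g t) → 0 ≤ Λ g) ∧
      ∀ (ξ : ℝ) (hξ : 0 < ξ) (φ : ℝ → ℝ) (p : ℝ), ContinuousOn φ (Icc 0 N) →
        (∀ y ∈ Icc 0 N, φ y = 1 - p * y + stringVolterra a ξ φ y) → φ N = 0 →
        Λ (bernsteinKernel ξ hξ) = p := by
  have : IsFiniteMeasure (a.restrict (Ioc 0 N)) := ⟨by simpa using hN.lt_top⟩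
  have hmem : ∀ {μ : Measure ℝ} [IsFiniteMeasure (μ.restrict (Ioc 0 N))] {f : ℝ → ℝ},
      IntegrableOn f (Ioc 0 N) μ → (∃ C, ∀ y ∈ Ioc 0 N, |f y| ≤ C) →
      MemLp (fun y => (f y : ℂ)) 2 (μ.restrict (Ioc 0 N)) := by
    rintro μ _ f hf ⟨C, hC⟩
    refine MemLp.of_bound hf.ofReal.aestronglyMeasurable C ?_
    filter_upwards [ae_restrict_mem measurableSet_Ioc] with y hy
    simpa using hC y hy
  have hmemC : ∀ {f : ℝ → ℝ}, ContinuousOn f (Icc 0 N) →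
      MemLp (fun y => (f y : ℂ)) 2 (a.restrict (Ioc 0 N)) := fun hf =>
    hmem (integrableOn_Ioc_of_continuousOn hN hf le_rfl)
      ((exists_abs_le_of_continuousOn hf).imp fun M hM y hy => hM.2 y (Ioc_subset_Icc_self hy))
  obtain ⟨T, hT⟩ := exists_dirichlet_primitive hN0 hN
  have hhc : ContinuousOn (fun y : ℝ => 1 - y / N) (Icc 0 N) := by fun_prop
  set h : Lp ℂ 2 (a.restrict (Ioc 0 N)) := (hmemC hhc).toLp _
  obtain ⟨Λ, hΛ, hspec⟩ := exists_functional_of_isPositive _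
    (ContinuousLinearMap.isPositive_self_comp_adjoint T) h
  let ev : C(unitInterval, ℝ) →ₗ[ℝ] ℝ :=
    { toFun := fun g => g 0, map_add' := fun _ _ => rfl, map_smul' := fun _ _ => rfl }
  refine ⟨Λ + (1 / N) • ev, fun g hg => ?_, fun ξ hξ φ p hφ heq hφN => ?_⟩
  · exact add_nonneg (hΛ g hg) (mul_nonneg (by positivity) (hg 0))
  have hp := sub_inv_eq_of_eq_stringVolterra hN0 hN hφ heq hφN
  set u : Lp ℂ 2 (a.restrict (Ioc 0 N)) := (hmemC hφ).toLp _
  have hucoe : u =ᵐ[a.restrict (Ioc 0 N)] fun y => (φ y : ℂ) := (hmemC hφ).coeFn_toLp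
  have hhcoe : h =ᵐ[a.restrict (Ioc 0 N)] fun y => ((1 - y / N : ℝ) : ℂ) :=
    (hmemC hhc).coeFn_toLp
  set s : ℝ → ℝ := fun t => stringSlope a ξ φ t - (p - 1 / N) with hs
  have hsint : IntegrableOn s (Ioc 0 N) :=
    ((integrableOn_stringSlope hξ.le hN hφ).mono_set Ioc_subset_Icc_self).sub (by simp)
  have hsmem : MemLp (fun y => (s y : ℂ)) 2 (volume.restrict (Ioc 0 N)) := by
    refine hmem hsint ?_
    obtain ⟨M, hM0, hM⟩ := exists_abs_le_of_continuousOn hφ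
    refine ⟨ξ * (M * a.real (Ioc 0 N)) + |p - 1 / N|, fun y hy => (abs_sub _ _).trans ?_⟩
    exact add_le_add_left (abs_stringSlope_le hξ.le hN hy.2
      (fun z hz => hM z ⟨hz.1.le, hz.2.trans hy.2⟩) hM0) _
  set w : Lp ℂ 2 (volume.restrict (Ioc 0 N)) := hsmem.toLp _
  have hwcoe : w =ᵐ[volume.restrict (Ioc 0 N)] fun y => (s y : ℂ) := hsmem.coeFn_toLp
  have hwT : w = -((ξ : ℂ) • ContinuousLinearMap.adjoint T u) := by
    refine ext_inner_left ℂ fun g => ?_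
    rw [inner_neg_right, inner_smul_right, ContinuousLinearMap.adjoint_inner_right, L2.inner_def,
      L2.inner_def]
    have hg : IntegrableOn (fun t => (starRingEnd ℂ) (g t)) (Ioc 0 N) :=
      (LinearIsometryEquiv.integrable_comp_iff Complex.conjLIE).2
        ((Lp.memLp g).integrable one_le_two)
    have hi1 : IntegrableOn (fun t => (stringSlope a ξ φ t : ℂ) * (starRingEnd ℂ) (g t))
        (Ioc 0 N) := by
      have h1 : Integrable (fun t => inner ℂ (g t) (w t)) (volume.restrict (Ioc 0 N)) :=
        L2.integrable_inner (𝕜 := ℂ) g w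
      refine (h1.add (hg.const_mul ((p - 1 / N : ℝ) : ℂ))).congr ?_
      filter_upwards [hwcoe] with t ht
      simp only [Pi.add_apply, ht, hs, RCLike.inner_apply]
      push_cast; ring
    set J := ∫ t in Ioc 0 N, (starRingEnd ℂ) (g t) with hJ
    have hl : ∫ t in Ioc 0 N, inner ℂ (g t) (w t) =
        (∫ t in Ioc 0 N, (stringSlope a ξ φ t : ℂ) * (starRingEnd ℂ) (g t)) -
          ((p - 1 / N : ℝ) : ℂ) * J := by
      rw [hJ, ← integral_const_mul, ← integral_sub hi1 (hg.const_mul _)]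
      refine integral_congr_ae ?_
      filter_upwards [hwcoe] with t ht
      simp only [ht, hs, RCLike.inner_apply]
      push_cast; ring
    have hi2 : Integrable (fun y => inner ℂ (T g y) (u y)) (a.restrict (Ioc 0 N)) :=
      L2.integrable_inner (𝕜 := ℂ) (T g) u
    have hi3 : IntegrableOn (fun z => ((φ z * (1 - z / N) : ℝ) : ℂ)) (Ioc 0 N) a :=
      (integrableOn_Ioc_of_continuousOn hN (hφ.mul hhc) le_rfl).ofReal
    rw [hl, setIntegral_stringSlope_mul hN hφ hg, hp, Complex.ofReal_mul,
      ← integral_complex_ofReal, mul_assoc, ← mul_sub, ← mul_neg, ← integral_mul_const]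
    congr 1
    rw [sub_eq_iff_eq_add', ← sub_eq_add_neg, ← integral_sub (hi3.mul_const J) hi2]
    refine integral_congr_ae ?_
    filter_upwards [hucoe, hT g] with z h1 h2
    simp only [h1, h2, RCLike.inner_apply, map_sub, map_mul, Complex.conj_ofReal, ← integral_conj]
    push_cast; ring
  have hTw : T w = u - h := by
    have hprim : ∀ y ∈ Icc 0 N, ∫ t in Ioc 0 y, w t = ((φ y - 1 + y / N : ℝ) : ℂ) := by
      intro y hy
      have h0 : (0 : ℝ) ∈ Icc 0 N := ⟨le_rfl, hN0.le⟩
      have h1 := ae_restrict_of_ae_restrict_of_subset (Ioc_subset_Ioc_right hy.2) hwcoe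
      rw [integral_congr_ae h1, integral_complex_ofReal, ← intervalIntegral.integral_of_le hy.1]
      simp only [hs]
      rw [intervalIntegral.integral_sub (intervalIntegrable_stringSlope hξ.le hN hφ h0 hy)
        (by simp), heq y hy, stringVolterra, intervalIntegral.integral_const]
      congr 1
      simp only [smul_eq_mul]
      ring
    refine Lp.ext ?_
    filter_upwards [hT w, Lp.coeFn_sub u h, hucoe, hhcoe, ae_restrict_mem measurableSet_Ioc]
      with y h1 h2 h3 h4 hy
    rw [h1, h2, Pi.sub_apply, h3, h4, hprim y (Ioc_subset_Icc_self hy),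
      hprim N ⟨hN0.le, le_rfl⟩, hφN, div_self hN0.ne']
    push_cast; ring
  have hmain : u + (ξ : ℂ) • (T ∘L ContinuousLinearMap.adjoint T) u = h := by
    have h1 : (ξ : ℂ) • (T ∘L ContinuousLinearMap.adjoint T) u = - T w := by
      rw [hwT, map_neg, map_smul, neg_neg]; rfl
    rw [h1, hTw]; abel
  have hin : inner ℂ h u = ((∫ z in Ioc 0 N, φ z * (1 - z / N) ∂a : ℝ) : ℂ) := by
    rw [L2.inner_def, ← integral_complex_ofReal]
    refine integral_congr_ae ?_
    filter_upwards [hucoe, hhcoe] with y h1 h2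
    rw [h1, h2, RCLike.inner_apply, Complex.conj_ofReal]
    push_cast; ring
  have h1 := hspec ξ hξ u hmain
  rw [hin, Complex.ofReal_re, ← hp] at h1
  have h2 : ev (bernsteinKernel ξ hξ) = 1 := by
    change bernsteinKernel ξ hξ 0 = 1
    simp [bernsteinKernel_apply, hξ.ne']
  simp [h1, h2]

end Truncated

lemma Icc_subset_IsetOf {R : ℝ≥0∞} {y : ℝ} (hy : y ∈ IsetOf R) : Icc 0 y ⊆ IsetOf R :=
  fun _ hz => ⟨hz.1, (ENNReal.ofReal_le_ofReal hz.2).trans_lt hy.2⟩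

lemma exists_seq_IsetOf {R : ℝ≥0∞} (hR : 0 < R) :
    ∃ N : ℕ → ℝ, Monotone N ∧ (∀ k, 0 < N k) ∧ (∀ k, N k ∈ IsetOf R) ∧
      ∀ y ∈ IsetOf R, ∀ᶠ k in atTop, y < N k := by
  obtain ⟨u, hmono, hu, hlim⟩ := exists_seq_strictMono_tendsto' hR
  have htop : ∀ k, u k ≠ ⊤ := fun k => (hu k).2.ne_top
  refine ⟨fun k => (u k).toReal,
    fun i j hij => ENNReal.toReal_mono (htop j) (hmono.monotone hij),
    fun k => ENNReal.toReal_pos (hu k).1.ne' (htop k),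
    fun k => ⟨ENNReal.toReal_nonneg, by rw [ENNReal.ofReal_toReal (htop k)]; exact (hu k).2⟩,
    fun y hy => ?_⟩
  filter_upwards [hlim.eventually (lt_mem_nhds hy.2)] with k hk
  exact (ENNReal.ofReal_lt_iff_lt_toReal hy.1 (htop k)).1 hk

lemma exists_gt_mem_IsetOf {R : ℝ≥0∞} {y : ℝ} (hy : y ∈ IsetOf R) : ∃ Y ∈ IsetOf R, y < Y := by
  obtain ⟨N, -, -, hN, hlt⟩ := exists_seq_IsetOf (zero_le.trans_lt hy.2)
  obtain ⟨k, hk⟩ := (hlt y hy).exists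
  exact ⟨N k, hN k, hk⟩

lemma LocallyFiniteOnHalf.measure_Ioc_ne_top {R : ℝ≥0∞} {a : Measure ℝ}
    (ha : LocallyFiniteOnHalf R a) {y : ℝ} (hy : y ∈ IsetOf R) : a (Ioc 0 y) ≠ ⊤ :=
  measure_ne_top_of_subset Ioc_subset_Icc_self (ha.2 y hy).ne

section Fundamental

variable {a : Measure ℝ} {ξ Y : ℝ}

/-- The solution of `φ″ = ξ φ a` with `φ(0) = 1` and `φ′(0⁺) = -c`. -/
def stringCauchy (a : Measure ℝ) (ξ c : ℝ) (y : ℝ) : ℝ :=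
  stringSol a ξ (fun _ => 1) y - c * stringSol a ξ (fun y => y) y

/-- The value of `-φ′(0⁺)` for which the solution with `φ(0) = 1` vanishes at `N`. -/
def stringRatio (a : Measure ℝ) (ξ N : ℝ) : ℝ :=
  stringSol a ξ (fun _ => 1) N / stringSol a ξ (fun y => y) N

lemma stringCauchy_continuousOn (hξ : 0 ≤ ξ) (hY : a (Ioc 0 Y) ≠ ⊤) (c : ℝ) :
    ContinuousOn (stringCauchy a ξ c) (Icc 0 Y) :=
  (stringSol_spec hξ hY continuousOn_const).1.sub
    (continuousOn_const.mul (stringSol_spec hξ hY continuousOn_id).1)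

lemma stringCauchy_eq (hξ : 0 ≤ ξ) (hY : a (Ioc 0 Y) ≠ ⊤) (c : ℝ) {y : ℝ} (hy : y ∈ Icc 0 Y) :
    stringCauchy a ξ c y = 1 - c * y + stringVolterra a ξ (stringCauchy a ξ c) y := by
  have hA := stringSol_spec (f := fun _ => 1) hξ hY continuousOn_const
  have hB := stringSol_spec (f := fun y => y) hξ hY continuousOn_id
  have hcB : ContinuousOn (fun y => c * stringSol a ξ (fun y => y) y) (Icc 0 Y) :=
    continuousOn_const.mul hB.1
  have h := stringVolterra_sub hξ hY hA.1 hcB hy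
  rw [stringVolterra_const_mul] at h
  unfold stringCauchy
  rw [h, hA.2 y hy, hB.2 y hy]
  ring

lemma le_stringSol_id (hξ : 0 ≤ ξ) (hY : a (Ioc 0 Y) ≠ ⊤) {y : ℝ} (hy : y ∈ Icc 0 Y) :
    y ≤ stringSol a ξ (fun y => y) y :=
  le_stringSol hξ hY continuousOn_id (fun _ h => h.1) hy

lemma stringCauchy_stringRatio_self (hξ : 0 ≤ ξ) (hY0 : 0 < Y) (hY : a (Ioc 0 Y) ≠ ⊤) :
    stringCauchy a ξ (stringRatio a ξ Y) Y = 0 := by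
  have h := hY0.trans_le (le_stringSol_id hξ hY ⟨hY0.le, le_rfl⟩)
  rw [stringCauchy, stringRatio, div_mul_cancel₀ _ h.ne', sub_self]

lemma stringRatio_nonneg (hξ : 0 ≤ ξ) (hY0 : 0 < Y) (hY : a (Ioc 0 Y) ≠ ⊤) :
    0 ≤ stringRatio a ξ Y :=
  div_nonneg
    (zero_le_one.trans (le_stringSol hξ hY continuousOn_const (fun _ _ => zero_le_one)
      ⟨hY0.le, le_rfl⟩))
    (hY0.le.trans (le_stringSol_id hξ hY ⟨hY0.le, le_rfl⟩))

lemma stringRatio_le (hξ : 0 ≤ ξ) {y : ℝ} (hy0 : 0 < y) (hyY : y ≤ Y) (hY : a (Ioc 0 Y) ≠ ⊤) :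
    stringRatio a ξ Y ≤ stringRatio a ξ y := by
  have hy : y ∈ Icc 0 Y := ⟨hy0.le, hyY⟩
  have h := nonneg_of_eq_stringVolterra hξ hY (stringCauchy_continuousOn hξ hY _)
    (fun _ hz => stringCauchy_eq hξ hY _ hz)
    (stringCauchy_stringRatio_self hξ (hy0.trans_le hyY) hY) y hy
  have hB := hy0.trans_le (le_stringSol_id hξ hY hy)
  rw [stringCauchy, sub_nonneg] at h
  rwa [stringRatio.eq_def a ξ y, le_div_iff₀ hB]

end Fundamental

/-- The Cauchy solution whose slope is the limit of the Dirichlet slopes is a string solution. -/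
lemma isStringSolution_stringCauchy {R : ℝ≥0∞} {a : Measure ℝ} (ha : LocallyFiniteOnHalf R a)
    {ξ c : ℝ} (hξ : 0 ≤ ξ) {N : ℕ → ℝ} (hN0 : ∀ k, 0 < N k) (hN : ∀ k, N k ∈ IsetOf R)
    (hlt : ∀ y ∈ IsetOf R, ∀ᶠ k in atTop, y < N k)
    (hc : Tendsto (fun k => stringRatio a ξ (N k)) atTop (𝓝 c)) :
    IsStringSolution R a ξ (stringCauchy a ξ c)
      (fun y => stringSlope a ξ (stringCauchy a ξ c) y - c) := by
  have hfin := fun {y} hy => ha.measure_Ioc_ne_top (y := y) hy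
  have hcont : ∀ Y ∈ IsetOf R, ContinuousOn (stringCauchy a ξ c) (Icc 0 Y) := fun Y hY =>
    stringCauchy_continuousOn hξ (hfin hY) c
  have heq : ∀ y ∈ IsetOf R, stringCauchy a ξ c y =
      1 - c * y + stringVolterra a ξ (stringCauchy a ξ c) y := fun y hy =>
    stringCauchy_eq hξ (hfin hy) c ⟨hy.1, le_rfl⟩
  have hlim : ∀ y, Tendsto (fun k => stringCauchy a ξ (stringRatio a ξ (N k)) y) atTop
      (𝓝 (stringCauchy a ξ c y)) := fun y =>
    tendsto_const_nhds.sub (hc.mul_const _)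
  have hnonneg : ∀ y ∈ IsetOf R, 0 ≤ stringCauchy a ξ c y := fun y hy =>
    ge_of_tendsto (hlim y) <| (hlt y hy).mono fun k hk =>
      nonneg_of_eq_stringVolterra hξ (hfin (hN k)) (stringCauchy_continuousOn hξ (hfin (hN k)) _)
        (fun _ hz => stringCauchy_eq hξ (hfin (hN k)) _ hz)
        (stringCauchy_stringRatio_self hξ (hN0 k) (hfin (hN k))) y ⟨hy.1, hk.le⟩
  have hle : ∀ y ∈ IsetOf R, ∀ᶠ k in atTop,
      stringCauchy a ξ (stringRatio a ξ (N k)) y ≤ 1 - y / N k := fun y hy =>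
    (hlt y hy).mono fun k hk => by
      have h := mul_le_of_eq_stringVolterra hξ (hfin (hN k))
        (stringCauchy_continuousOn hξ (hfin (hN k)) _)
        (fun _ hz => stringCauchy_eq hξ (hfin (hN k)) _ hz)
        (stringCauchy_stringRatio_self hξ (hN0 k) (hfin (hN k))) (y := y) ⟨hy.1, hk.le⟩
      rw [one_sub_div (hN0 k).ne', le_div_iff₀ (hN0 k)]
      linarith
  refine
    { init := ?_
      deriv_integrable := fun y hy =>
        (integrableOn_stringSlope hξ (hfin hy) (hcont y hy)).sub (by simp)
      locAC := fun y hy => ?_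
      right_cont := fun y hy _ => ?_
      bounded := ⟨1, fun y hy => ?_⟩
      boundary := fun hR => ?_
      integ_a := fun y hy => (hcont y hy).integrableOn_of_subset_isCompact isCompact_Icc
        measurableSet_Icc subset_rfl (ha.2 y hy).ne
      eqn := fun y₁ y₂ h₁ h₁₂ h₂ => ?_ }
  · rw [heq 0 (Icc_subset_IsetOf (hN 0) ⟨le_rfl, (hN0 0).le⟩)]
    simp [stringVolterra]
  · rw [heq y hy, intervalIntegral.integral_sub (intervalIntegrable_stringSlope hξ (hfin hy)
      (hcont y hy) ⟨le_rfl, hy.1⟩ ⟨hy.1, le_rfl⟩) (by simp), stringVolterra]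
    simp
    ring
  · obtain ⟨Y, hY, hyY⟩ := exists_gt_mem_IsetOf hy
    rw [← continuousWithinAt_Ioi_iff_Ici]
    exact (tendsto_stringSlope (hfin hY) (hcont Y hY) hyY).sub_const c
  · rw [abs_of_nonneg (hnonneg y hy)]
    refine le_of_tendsto (hlim y) ((hle y hy).mono fun k hk => hk.trans ?_)
    linarith [div_nonneg hy.1 (hN0 k).le]
  · have hRpos : 0 < R.toReal :=
      ENNReal.toReal_pos (zero_le.trans_lt (hN 0).2).ne' hR
    have hev : ∀ᶠ y in 𝓝[<] R.toReal, y ∈ IsetOf R := by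
      filter_upwards [Ioo_mem_nhdsLT hRpos] with y hy
      exact ⟨hy.1.le, (ENNReal.ofReal_lt_iff_lt_toReal hy.1.le hR).2 hy.2⟩
    have hup : Tendsto (fun y => 1 - y / R.toReal) (𝓝[<] R.toReal) (𝓝 0) := by
      have h : Continuous fun y => 1 - y / R.toReal := by fun_prop
      have h1 := h.tendsto R.toReal
      rw [div_self hRpos.ne', sub_self] at h1
      exact h1.mono_left nhdsWithin_le_nhds
    refine tendsto_of_tendsto_of_tendsto_of_le_of_le' tendsto_const_nhds hup
      (hev.mono hnonneg) (hev.mono fun y hy => ?_)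
    refine le_of_tendsto (hlim y) ((hle y hy).mono fun k hk => hk.trans ?_)
    have h1 := ((ENNReal.ofReal_lt_iff_lt_toReal (hN k).1 hR).1 (hN k).2).le
    have h2 := div_le_div_of_nonneg_left hy.1 (hN0 k) h1
    linarith
  · rw [sub_sub_sub_cancel_right]
    exact stringSlope_sub_eq (hfin h₂) (hcont y₂ h₂) h₁.le h₁₂ le_rfl

lemma IsStringSolution.exists_slope {R : ℝ≥0∞} (hR : 0 < R) {a : Measure ℝ}
    (ha : LocallyFiniteOnHalf R a) {ξ : ℝ} {φ v : ℝ → ℝ} (h : IsStringSolution R a ξ φ v) :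
    ∃ L, Tendsto v (𝓝[>] 0) (𝓝 L) ∧ ∀ Y ∈ IsetOf R, ContinuousOn φ (Icc 0 Y) ∧
      ∀ y ∈ Icc 0 Y, φ y = 1 + L * y + stringVolterra a ξ φ y := by
  have hcont : ∀ Y ∈ IsetOf R, ContinuousOn φ (Icc 0 Y) := by
    intro Y hY
    have h1 := intervalIntegral.continuousOn_primitive_interval (f := v) (a := 0) (b := Y)
      (μ := volume) (by rw [uIcc_of_le hY.1]; exact h.deriv_integrable Y hY)
    rw [uIcc_of_le hY.1] at h1
    exact (continuousOn_const.add h1).congr fun y hy => h.locAC y (Icc_subset_IsetOf hY hy)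
  obtain ⟨N, -, hN0, hN, -⟩ := exists_seq_IsetOf hR
  set y₀ := N 0
  have hv : ∀ t ∈ IsetOf R, 0 < t →
      v t = v y₀ - stringSlope a ξ φ y₀ + stringSlope a ξ φ t := by
    intro t ht ht0
    rcases le_total t y₀ with hle | hle
    · have h1 := h.eqn t y₀ ht0 hle (hN 0)
      have h2 := stringSlope_sub_eq (ξ := ξ) (ha.measure_Ioc_ne_top (hN 0)) (hcont _ (hN 0))
        ht0.le hle le_rfl
      linarith
    · have h1 := h.eqn y₀ t (hN0 0) hle ht
      have h2 := stringSlope_sub_eq (ξ := ξ) (ha.measure_Ioc_ne_top ht) (hcont _ ht)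
        (hN0 0).le hle le_rfl
      linarith
  refine ⟨v y₀ - stringSlope a ξ φ y₀, ?_, fun Y hY => ⟨hcont Y hY, fun y hy => ?_⟩⟩
  · have h1 := (tendsto_stringSlope (ξ := ξ) (ha.measure_Ioc_ne_top (hN 0)) (hcont _ (hN 0))
      (hN0 0)).const_add (v y₀ - stringSlope a ξ φ y₀)
    have h2 : stringSlope a ξ φ 0 = 0 := by simp [stringSlope]
    rw [h2, add_zero] at h1
    refine h1.congr' ?_
    filter_upwards [Ioo_mem_nhdsGT (hN0 0)] with t ht
    exact (hv t (Icc_subset_IsetOf (hN 0) ⟨ht.1.le, ht.2.le⟩) ht.1).symm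
  · have hyI := Icc_subset_IsetOf hY hy
    generalize v y₀ - stringSlope a ξ φ y₀ = L at hv ⊢
    have h1 : stringVolterra a ξ φ y = ∫ t in (0 : ℝ)..y, (v t - L) := by
      rw [stringVolterra, intervalIntegral.integral_of_le hy.1,
        intervalIntegral.integral_of_le hy.1]
      refine setIntegral_congr_fun measurableSet_Ioc fun t ht => ?_
      simp only [hv t (Icc_subset_IsetOf hyI ⟨ht.1.le, ht.2⟩) ht.1]
      ring
    have h2 : IntervalIntegrable v volume 0 y :=
      (intervalIntegrable_iff_integrableOn_Icc_of_le hy.1).2 (h.deriv_integrable y hyI)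
    rw [h1, intervalIntegral.integral_sub h2 (by simp), h.locAC y hyI]
    simp
    ring

lemma IsStringSolution.unique {R : ℝ≥0∞} (hR : 0 < R) {a : Measure ℝ}
    (ha : LocallyFiniteOnHalf R a) {ξ : ℝ} (hξ : 0 ≤ ξ) {φ v φ' v' : ℝ → ℝ} {L : ℝ}
    (h : IsStringSolution R a ξ φ v) (hL : Tendsto v (𝓝[>] 0) (𝓝 L))
    (h' : IsStringSolution R a ξ φ' v') :
    (∀ y ∈ IsetOf R, φ' y = φ y) ∧ Tendsto v' (𝓝[>] 0) (𝓝 L) := by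
  obtain ⟨L₁, hL₁, hs⟩ := h.exists_slope hR ha
  obtain ⟨L', hL', hs'⟩ := h'.exists_slope hR ha
  obtain rfl := tendsto_nhds_unique hL hL₁
  set B := stringSol a ξ fun y => y with hB
  have hdiff : ∀ y ∈ IsetOf R, φ' y - φ y = (L' - L) * B y := by
    intro y hy
    have hfin := ha.measure_Ioc_ne_top hy
    have hBs := stringSol_spec (f := fun y => y) hξ hfin continuousOn_id
    have hBc : ContinuousOn (fun y => (L' - L) * B y) (Icc 0 y) := continuousOn_const.mul hBs.1
    have hc : ContinuousOn (fun y => φ' y - φ y) (Icc 0 y) := (hs' y hy).1.sub (hs y hy).1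
    refine sub_eq_zero.1 (eq_zero_of_eq_stringVolterra
      (f := fun y => φ' y - φ y - (L' - L) * B y) hξ hfin (hc.sub hBc) (fun z hz => ?_)
      ⟨hy.1, le_rfl⟩)
    rw [stringVolterra_sub hξ hfin hc hBc hz,
      stringVolterra_sub hξ hfin (hs' y hy).1 (hs y hy).1 hz, stringVolterra_const_mul,
      (hs' y hy).2 z hz, (hs y hy).2 z hz, hB, hBs.2 z hz]
    ring
  have hBle : ∀ y ∈ IsetOf R, |L' - L| * y ≤ |φ' y - φ y| := by
    intro y hy
    have h1 := le_stringSol_id hξ (ha.measure_Ioc_ne_top hy) ⟨hy.1, le_rfl⟩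
    rw [hdiff y hy, abs_mul, abs_of_nonneg (hy.1.trans h1)]
    exact mul_le_mul_of_nonneg_left h1 (abs_nonneg _)
  have hzero : L' - L = 0 := by
    by_contra hne
    have hpos := abs_pos.2 hne
    rcases eq_or_ne R ⊤ with rfl | hRt
    · obtain ⟨M, hM⟩ := h.bounded
      obtain ⟨M', hM'⟩ := h'.bounded
      have hM0 : 0 ≤ M + M' := by
        have h0 : (0 : ℝ) ∈ IsetOf ⊤ := ⟨le_rfl, ENNReal.ofReal_lt_top⟩
        exact add_nonneg ((abs_nonneg _).trans (hM 0 h0)) ((abs_nonneg _).trans (hM' 0 h0))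
      have hy : (M + M' + 1) / |L' - L| ∈ IsetOf ⊤ := ⟨by positivity, ENNReal.ofReal_lt_top⟩
      have h1 := hBle _ hy
      rw [mul_div_cancel₀ _ hpos.ne'] at h1
      linarith [abs_sub (φ' ((M + M' + 1) / |L' - L|)) (φ ((M + M' + 1) / |L' - L|)),
        hM _ hy, hM' _ hy]
    · have hRpos : 0 < R.toReal := ENNReal.toReal_pos hR.ne' hRt
      have h1 := ((h'.boundary hRt).sub (h.boundary hRt)).abs
      rw [sub_zero, abs_zero] at h1
      have h2 : Tendsto (fun y => |L' - L| * y) (𝓝[<] R.toReal) (𝓝 (|L' - L| * R.toReal)) :=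
        (tendsto_id.mono_left nhdsWithin_le_nhds).const_mul _
      have h3 := le_of_tendsto_of_tendsto h2 h1 (by
        filter_upwards [Ioo_mem_nhdsLT hRpos] with y hy
        exact hBle y ⟨hy.1.le, (ENNReal.ofReal_lt_iff_lt_toReal hy.1.le hRt).2 hy.2⟩)
      exact absurd h3 (not_le.2 (mul_pos hpos hRpos))
  refine ⟨fun y hy => ?_, ?_⟩
  · have h1 := hdiff y hy
    rw [hzero, zero_mul] at h1
    linarith
  · rwa [← sub_eq_zero.1 hzero]

/-- For every Krein string: `R ∈ (0, ∞]` and a locally finite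
nonnegative Borel measure `a` on `[0, R)`, and every `ξ > 0`, the string equation has
exactly one solution `φ_ξ`, the right limit `φ_ξ′(0⁺)` exists, and
`ψ(ξ) = −φ_ξ′(0⁺) + a({0}) ξ` is a complete Bernstein function. -/
theorem statement10 (R : ℝ≥0∞) (hR : 0 < R) (a : Measure ℝ)
    (ha : LocallyFiniteOnHalf R a) :
    ∃ ψ : ℝ → ℝ, IsCompleteBernstein ψ ∧
      ∀ ξ : ℝ, 0 < ξ →
        ∃ (φ v : ℝ → ℝ) (L : ℝ),
          IsStringSolution R a ξ φ v ∧
          Filter.Tendsto v (nhdsWithin 0 (Set.Ioi 0)) (nhds L) ∧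
          ψ ξ = -L + (a ({0} : Set ℝ)).toReal * ξ ∧
          ∀ φ' v' : ℝ → ℝ, IsStringSolution R a ξ φ' v' →
            (∀ y ∈ IsetOf R, φ' y = φ y) ∧
            Filter.Tendsto v' (nhdsWithin 0 (Set.Ioi 0)) (nhds L) := by
  obtain ⟨N, hmono, hN0, hN, hlt⟩ := exists_seq_IsetOf hR
  have hfin := fun k => ha.measure_Ioc_ne_top (hN k)
  choose Λ hΛ hspec using fun k => exists_functional_truncated (hN0 k) (hfin k)
  let ev : C(unitInterval, ℝ) →ₗ[ℝ] ℝ :=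
    { toFun := fun g => g 1, map_add' := fun _ _ => rfl, map_smul' := fun _ _ => rfl }
  have hlim : ∀ ξ, 0 < ξ → Tendsto (fun k => stringRatio a ξ (N k)) atTop
      (𝓝 (⨅ k, stringRatio a ξ (N k))) := fun ξ hξ =>
    tendsto_atTop_ciInf
      (fun i j hij => stringRatio_le hξ.le (hN0 i) (hmono hij) (hfin j))
      ⟨0, by rintro _ ⟨k, rfl⟩; exact stringRatio_nonneg hξ.le (hN0 k) (hfin k)⟩
  have hratio : ∀ ξ (hξ : 0 < ξ) k, Λ k (bernsteinKernel ξ hξ) = stringRatio a ξ (N k) :=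
    fun ξ hξ k => hspec k ξ hξ _ _ (stringCauchy_continuousOn hξ.le (hfin k) _)
      (fun _ hy => stringCauchy_eq hξ.le (hfin k) _ hy)
      (stringCauchy_stringRatio_self hξ.le (hN0 k) (hfin k))
  refine ⟨fun ξ => (⨅ k, stringRatio a ξ (N k)) + (a {0}).toReal * ξ, ?_, fun ξ hξ => ?_⟩
  · obtain ⟨Λ', hΛ', hψ⟩ := exists_functional_of_tendsto (fun k => Λ k + (a {0}).toReal • ev)
      (fun k g hg => add_nonneg (hΛ k g hg) (mul_nonneg ENNReal.toReal_nonneg (hg 1)))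
      (fun ξ => (⨅ k, stringRatio a ξ (N k)) + (a {0}).toReal * ξ) (fun ξ hξ => by
        have h1 : ev (bernsteinKernel ξ hξ) = ξ := by
          change bernsteinKernel ξ hξ 1 = ξ
          simp [bernsteinKernel_apply]
        simp only [LinearMap.add_apply, LinearMap.smul_apply, hratio, h1, smul_eq_mul]
        exact (hlim ξ hξ).add_const _)
    exact isCompleteBernstein_of_functional Λ' hΛ' _ hψ
  · set c := ⨅ k, stringRatio a ξ (N k)
    have hsol := isStringSolution_stringCauchy ha hξ.le hN0 hN hlt (hlim ξ hξ)
    have hL : Tendsto (fun y => stringSlope a ξ (stringCauchy a ξ c) y - c) (𝓝[>] 0)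
        (𝓝 (-c)) := by
      have h := (tendsto_stringSlope (ξ := ξ) (hfin 0)
        (stringCauchy_continuousOn hξ.le (hfin 0) c) (hN0 0)).sub_const c
      simpa [stringSlope] using h
    exact ⟨_, _, -c, hsol, hL, by rw [neg_neg], fun φ' v' h' => hsol.unique hR ha hξ.le hL h'⟩
end
end

section
/- Let F be a Rogers function such that F(ξ) is real for every ξ ∈ (0,∞) (this corresponds to the characteristic exponent of a symmetric Lévy process with completely monotone jumps). Then there exists a complete Bernstein function Φ such that F(ξ) = Φ(ξ²) for every ξ > 0. -/
open MeasureTheory Filter Set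
open scoped ENNReal Topology

noncomputable section

/-- A *Rogers function*: holomorphic on the right half-plane, with `Re (F z / z) ≥ 0` there. -/
def IsRogersFunction (F : ℂ → ℂ) : Prop :=
  DifferentiableOn ℂ F {z : ℂ | 0 < z.re} ∧ ∀ z : ℂ, 0 < z.re → 0 ≤ (F z / z).re

/-- `Ψ` extends to a Rogers function: some Rogers function agrees with `Ψ` on `(0, ∞)`. -/
def ExtendsToRogersFunction (Ψ : ℝ → ℂ) : Prop :=
  ∃ F : ℂ → ℂ, IsRogersFunction F ∧ ∀ ξ : ℝ, 0 < ξ → F (ξ : ℂ) = Ψ ξ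

/-- The Poisson kernel of the right half-plane at the boundary, in the variable
`η = ξ ^ 2` and the coordinate `x` obtained by projecting the unit circle to `[-1, 1]`. -/
def cosKernel (η x : ℝ) : ℝ := 2 * η / (η * (1 - x) + (1 + x))

lemma cosKernel_denom_pos {η x : ℝ} (hη : 0 < η) (hx : x ∈ Icc (-1 : ℝ) 1) :
    0 < η * (1 - x) + (1 + x) := by
  obtain ⟨h₁, h₂⟩ := hx
  rcases h₂.lt_or_eq with h | rfl
  · have := mul_pos hη (sub_pos.2 h)
    linarith
  · norm_num

lemma continuous_cosKernel {η : ℝ} (hη : 0 < η) :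
    Continuous fun x : Icc (-1 : ℝ) 1 => cosKernel η x := by
  unfold cosKernel
  exact Continuous.div (by fun_prop) (by fun_prop) fun x => (cosKernel_denom_pos hη x.2).ne'

/-- The projection of the unit circle to the real axis, in the angular variable. -/
def cosIcc (θ : ℝ) : Icc (-1 : ℝ) 1 := ⟨Real.cos θ, Real.cos_mem_Icc θ⟩

lemma measurable_cosIcc : Measurable cosIcc := Real.measurable_cos.subtype_mk

lemma cayley_mem_ball {ξ : ℝ} (hξ : 0 < ξ) :
    (((ξ - 1) / (ξ + 1) : ℝ) : ℂ) ∈ Metric.ball (0 : ℂ) 1 := by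
  have hξ1 : 0 < ξ + 1 := by linarith
  rw [mem_ball_zero_iff, Complex.norm_real, Real.norm_eq_abs, abs_lt, lt_div_iff₀ hξ1,
    div_lt_iff₀ hξ1]
  constructor <;> linarith

lemma poissonKernel_circleMap {ξ : ℝ} (hξ : 0 < ξ) (θ : ℝ) :
    poissonKernel 0 (((ξ - 1) / (ξ + 1) : ℝ) : ℂ) (circleMap 0 1 θ)
      = cosKernel (ξ ^ 2) (Real.cos θ) / ξ := by
  have hd := cosKernel_denom_pos (pow_pos hξ 2) (Real.cos_mem_Icc θ)
  have hξ1 : ξ + 1 ≠ 0 := by positivity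
  have key : ‖circleMap 0 1 θ - (((ξ - 1) / (ξ + 1) : ℝ) : ℂ)‖ ^ 2
      = 2 * (ξ ^ 2 * (1 - Real.cos θ) + (1 + Real.cos θ)) / (ξ + 1) ^ 2 := by
    rw [← Complex.normSq_eq_norm_sq, Complex.normSq_apply]
    simp only [circleMap, Complex.sub_re, Complex.sub_im, Complex.ofReal_re, Complex.ofReal_im,
      zero_add, Complex.ofReal_one, one_mul, Complex.exp_ofReal_mul_I_re,
      Complex.exp_ofReal_mul_I_im]
    field_simp
    linear_combination (ξ + 1) ^ 2 * Real.sin_sq_add_cos_sq θ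
  rw [poissonKernel_def]
  simp only [sub_zero]
  rw [key, cosKernel, norm_circleMap_zero, Complex.norm_real, Real.norm_eq_abs, sq_abs, sq_abs]
  field_simp
  ring

/-- The Poisson formula on a circle of radius `r < 1`, written as integration against a finite
measure on `[-1, 1]`. -/
lemma exists_finiteMeasure_integral_cosKernel_of_lt_one {f : ℂ → ℂ}
    (hf : DifferentiableOn ℂ f (Metric.ball 0 1))
    (hpos : ∀ w ∈ Metric.ball (0 : ℂ) 1, 0 ≤ (f w).re)
    {r : ℝ} (hr₀ : 0 < r) (hr₁ : r < 1) :
    ∃ ν : FiniteMeasure (Icc (-1 : ℝ) 1), ∀ ξ : ℝ, 0 < ξ →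
      ξ * (f (r * ((ξ - 1) / (ξ + 1) : ℝ))).re =
        ∫ x, cosKernel (ξ ^ 2) x ∂(ν : Measure (Icc (-1 : ℝ) 1)) := by
  have hmem : ∀ w ∈ Metric.closedBall (0 : ℂ) 1, (r : ℂ) * w ∈ Metric.ball (0 : ℂ) 1 := by
    intro w hw
    simp only [mem_closedBall_zero_iff, mem_ball_zero_iff, norm_mul, Complex.norm_real,
      Real.norm_eq_abs, abs_of_pos hr₀] at hw ⊢
    nlinarith
  have hcirc (θ : ℝ) : circleMap 0 1 θ ∈ Metric.closedBall (0 : ℂ) 1 :=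
    circleMap_mem_closedBall 0 zero_le_one θ
  have hdiff : DifferentiableOn ℂ (fun w => f (r * w)) (Metric.closedBall 0 1) :=
    hf.comp (by fun_prop) hmem
  set p : ℝ → ℝ := fun θ => (2 * Real.pi)⁻¹ * (f (r * circleMap 0 1 θ)).re with hp
  have hp₀ (θ : ℝ) : 0 ≤ p θ := mul_nonneg (by positivity) (hpos _ (hmem _ (hcirc θ)))
  have hpc : Continuous p :=
    continuous_const.mul (Complex.continuous_re.comp
      (hdiff.continuousOn.comp_continuous (continuous_circleMap 0 1) hcirc))
  have hpi : Integrable p (volume.restrict (Ioc 0 (2 * Real.pi))) :=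
    (hpc.integrableOn_Icc (a := 0) (b := 2 * Real.pi)).mono_set Ioc_subset_Icc_self
  set ρ : Measure ℝ :=
    (volume.restrict (Ioc 0 (2 * Real.pi))).withDensity fun θ => ENNReal.ofReal (p θ) with hρ
  have : IsFiniteMeasure ρ := isFiniteMeasure_withDensity_ofReal hpi.2
  have : IsFiniteMeasure (ρ.map cosIcc) := Measure.isFiniteMeasure_map ρ cosIcc
  refine ⟨⟨ρ.map cosIcc, inferInstance⟩, fun ξ hξ => ?_⟩
  have hw := cayley_mem_ball hξ
  have hpoi := (hdiff.diffContOnCl_ball subset_rfl).circleAverage_poissonKernel_smul hw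
  rw [FiniteMeasure.toMeasure_mk,
    integral_map measurable_cosIcc.aemeasurable
      (continuous_cosKernel (pow_pos hξ 2)).aestronglyMeasurable, hρ,
    integral_withDensity_eq_integral_toReal_smul (by fun_prop) (by simp)]
  have hkc : Continuous fun θ => cosKernel (ξ ^ 2) (Real.cos θ) / ξ := by
    unfold cosKernel
    exact (Continuous.div (by fun_prop) (by fun_prop)
      fun θ => (cosKernel_denom_pos (pow_pos hξ 2) (Real.cos_mem_Icc θ)).ne').div_const ξ
  have hfc : Continuous fun θ : ℝ => f (r * circleMap 0 1 θ) :=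
    hdiff.continuousOn.comp_continuous (continuous_circleMap 0 1) hcirc
  simp only [Real.circleAverage, Pi.smul_apply', poissonKernel_circleMap hξ] at hpoi
  have hre := Complex.reCLM.intervalIntegral_comp_comm
    ((hkc.smul hfc).intervalIntegrable (μ := volume) 0 (2 * Real.pi))
  simp only [Pi.smul_apply'] at hre
  rw [← hpoi, Complex.smul_re, ← Complex.reCLM_apply, ← hre,
    intervalIntegral.integral_of_le (by positivity), smul_eq_mul, ← integral_const_mul,
    ← integral_const_mul]
  refine integral_congr_ae (Eventually.of_forall fun θ => ?_)
  dsimp only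
  rw [ENNReal.toReal_ofReal (hp₀ θ)]
  simp only [cosIcc, hp, Complex.reCLM_apply, Complex.smul_re, smul_eq_mul]
  field_simp

/-- The Herglotz representation on the real diameter: the measures of
`exists_finiteMeasure_integral_cosKernel_of_lt_one` have a cluster point as `r → 1`. -/
lemma exists_finiteMeasure_integral_cosKernel {f : ℂ → ℂ}
    (hf : DifferentiableOn ℂ f (Metric.ball 0 1))
    (hpos : ∀ w ∈ Metric.ball (0 : ℂ) 1, 0 ≤ (f w).re) :
    ∃ ν : FiniteMeasure (Icc (-1 : ℝ) 1), ∀ ξ : ℝ, 0 < ξ →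
      ξ * (f ((ξ - 1) / (ξ + 1) : ℝ)).re =
        ∫ x, cosKernel (ξ ^ 2) x ∂(ν : Measure (Icc (-1 : ℝ) 1)) := by
  obtain ⟨r, -, hr, hlim⟩ := exists_seq_strictMono_tendsto' (zero_lt_one (α := ℝ))
  choose ν hν using fun n =>
    exists_finiteMeasure_integral_cosKernel_of_lt_one hf hpos (hr n).1 (hr n).2
  have hmass (n : ℕ) : (ν n).mass ≤ (f 0).re.toNNReal := by
    have h := hν n 1 one_pos
    have h1 : ∀ x, cosKernel (1 ^ 2) x = 1 := fun x => by
      rw [cosKernel, div_eq_one_iff_eq] <;> ring_nf; norm_num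
    simp only [h1, sub_self, zero_div, Complex.ofReal_zero, mul_zero, one_mul, integral_const,
      smul_eq_mul, mul_one] at h
    rw [h]
    exact (Real.toNNReal_coe (r := (ν n).mass)).ge
  obtain ⟨ν', -, hν'⟩ := (isCompact_setOfPred_finiteMeasure_le_of_compactSpace
    (Icc (-1 : ℝ) 1) (f 0).re.toNNReal).ultrafilter_le_nhds'
      ((Ultrafilter.of (atTop : Filter ℕ)).map ν)
      (Ultrafilter.mem_map.2 (Eventually.of_forall hmass))
  refine ⟨ν', fun ξ hξ => ?_⟩
  have hw := cayley_mem_ball hξ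
  have h₁ : Tendsto (fun n => ∫ x, cosKernel (ξ ^ 2) x ∂(ν n : Measure (Icc (-1 : ℝ) 1)))
      (Ultrafilter.of (atTop : Filter ℕ) : Filter ℕ)
      (𝓝 (∫ x, cosKernel (ξ ^ 2) x ∂(ν' : Measure (Icc (-1 : ℝ) 1)))) := by
    exact FiniteMeasure.tendsto_iff_forall_integral_tendsto.1 (show Tendsto ν _ _ from hν')
      (BoundedContinuousFunction.mkOfCompact ⟨_, continuous_cosKernel (pow_pos hξ 2)⟩)
  have h₂ : Tendsto (fun n => ξ * (f (r n * ((ξ - 1) / (ξ + 1) : ℝ))).re) atTop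
      (𝓝 (ξ * (f ((ξ - 1) / (ξ + 1) : ℝ)).re)) := by
    have hc := (hf.differentiableAt (Metric.isOpen_ball.mem_nhds hw)).continuousAt
    have hlim' : Tendsto (fun n => (r n : ℂ) * (((ξ - 1) / (ξ + 1) : ℝ) : ℂ)) atTop
        (𝓝 (((ξ - 1) / (ξ + 1) : ℝ) : ℂ)) := by
      simpa using ((Complex.continuous_ofReal.tendsto 1).comp hlim).mul_const
        (((ξ - 1) / (ξ + 1) : ℝ) : ℂ)
    exact ((Complex.continuous_re.tendsto _).comp (hc.tendsto.comp hlim')).const_mul ξ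
  refine tendsto_nhds_unique (h₂.mono_left (Ultrafilter.of_le _)) ?_
  simpa only [← hν _ ξ hξ] using h₁

/-- Integrals of `cosKernel` against finite measures on `[-1, 1]` are complete Bernstein functions:
the endpoints give the affine part, and the change of variables `s = (1 + x) / (1 - x)` gives
the Stieltjes integral. -/
lemma isCompleteBernstein_of_eq_integral_cosKernel {Φ : ℝ → ℝ} (ν : Measure (Icc (-1 : ℝ) 1))
    [IsFiniteMeasure ν] (h : ∀ η : ℝ, 0 < η → Φ η = ∫ x, cosKernel η x ∂ν) :
    IsCompleteBernstein Φ := by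
  set T : Icc (-1 : ℝ) 1 → ℝ := fun x => (1 + x) / (1 - x) with hT
  have hTm : Measurable T := by fun_prop
  set m : Measure ℝ := (ν.map T).restrict (Ioi 0) with hm
  set μ : Measure ℝ := m.withDensity fun s => ENNReal.ofReal (1 + s) with hμ
  let a : Icc (-1 : ℝ) 1 := ⟨-1, by norm_num⟩
  let b : Icc (-1 : ℝ) 1 := ⟨1, by norm_num⟩
  have hmpos : ∀ᵐ s ∂m, 0 < s := ae_restrict_mem measurableSet_Ioi
  refine ⟨ν.real {a}, ν.real {b}, μ, by positivity, by positivity, ?_, ?_, fun η hη => ?_⟩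
  · refine withDensity_absolutelyContinuous _ _ ?_
    rw [hm, Measure.restrict_apply measurableSet_Iic, (Iic_disjoint_Ioi le_rfl).inter_eq,
      measure_empty]
  · rw [hμ, lintegral_withDensity_eq_lintegral_mul _ (by fun_prop) (by fun_prop)]
    calc _ = ∫⁻ _, 1 ∂m := by
          refine lintegral_congr_ae (hmpos.mono fun s hs => ?_)
          have : (0 : ℝ) < 1 + s := by positivity
          change ENNReal.ofReal (1 + s) * ENNReal.ofReal (1 + s)⁻¹ = 1
          rw [← ENNReal.ofReal_mul this.le, mul_inv_cancel₀ this.ne', ENNReal.ofReal_one]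
      _ < ⊤ := by simp [hm]
  have hkc : Continuous fun x : Icc (-1 : ℝ) 1 => cosKernel η x := continuous_cosKernel hη
  have hki : Integrable (fun x : Icc (-1 : ℝ) 1 => cosKernel η x) ν :=
    (BoundedContinuousFunction.mkOfCompact ⟨_, hkc⟩).integrable ν
  have hA : MeasurableSet (T ⁻¹' Ioi 0) := hTm measurableSet_Ioi
  have hcomp : ∀ x ∈ T ⁻¹' Ioi 0,
      (ENNReal.ofReal (1 + T x)).toReal • (η / (η + T x)) = cosKernel η x := by
    rintro ⟨x, hx⟩ hTx
    have hTx' : 0 < (1 + x) / (1 - x) := hTx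
    have hx1 : 1 - x ≠ 0 := fun h0 => by simp [h0] at hTx'
    have hd := (cosKernel_denom_pos hη hx).ne'
    rw [ENNReal.toReal_ofReal (by simp only [hT]; positivity), smul_eq_mul, cosKernel]
    simp only [hT]
    have hd' : η + (1 + x) / (1 - x) ≠ 0 := by positivity
    field_simp
    ring
  have hmeas : StronglyMeasurable fun s : ℝ =>
      (ENNReal.ofReal (1 + s)).toReal • (η / (η + s)) :=
    Measurable.stronglyMeasurable (by fun_prop)
  constructor
  · rw [hμ, integrable_withDensity_iff_integrable_smul' (by fun_prop) (by simp), hm,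
      Measure.restrict_map hTm measurableSet_Ioi,
      integrable_map_measure hmeas.aestronglyMeasurable hTm.aemeasurable]
    exact hki.integrableOn.congr_fun (fun x hx => (hcomp x hx).symm) hA
  · have hint : ∫ s, η / (η + s) ∂μ = ∫ x in T ⁻¹' Ioi 0, cosKernel η x ∂ν := by
      rw [hμ, integral_withDensity_eq_integral_toReal_smul (by fun_prop) (by simp), hm,
        setIntegral_map measurableSet_Ioi hmeas.aestronglyMeasurable hTm.aemeasurable]
      exact setIntegral_congr_fun hA hcomp
    have hsplit : ∀ x : Icc (-1 : ℝ) 1, cosKernel η x =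
        indicator {a} 1 x + indicator {b} (fun _ => η) x
          + indicator (T ⁻¹' Ioi 0) (fun x : Icc (-1 : ℝ) 1 => cosKernel η x) x := by
      rintro ⟨x, hx⟩
      by_cases h₁ : x = -1
      · subst h₁
        norm_num [indicator, a, b, T, cosKernel]
        field_simp
      by_cases h₂ : x = 1
      · subst h₂
        norm_num [indicator, a, b, T, cosKernel]
      have h₃ : -1 < x := lt_of_le_of_ne hx.1 (Ne.symm h₁)
      have h₄ : x < 1 := lt_of_le_of_ne hx.2 h₂
      have h₅ : 0 < (1 + x) / (1 - x) := div_pos (by linarith) (by linarith)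
      simp [indicator, a, b, T, h₁, h₂, h₅]
    rw [h η hη, hint, integral_congr_ae (Eventually.of_forall hsplit), integral_add, integral_add,
      integral_indicator hA, integral_indicator_one (measurableSet_singleton a),
      integral_indicator_const _ (measurableSet_singleton b), smul_eq_mul, mul_comm]
    · exact (integrable_const 1).indicator (measurableSet_singleton a)
    · exact (integrable_const η).indicator (measurableSet_singleton b)
    · exact ((integrable_const 1).indicator (measurableSet_singleton a)).add
        ((integrable_const η).indicator (measurableSet_singleton b))
    · exact hki.indicator hA

/-- If `F` is a Rogers function which takes real values on `(0, ∞)`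
(the symmetric case), then there is a complete Bernstein function `Φ` with
`F(ξ) = Φ(ξ²)` for every `ξ > 0`. -/
theorem statement13 (F : ℂ → ℂ) (hF : IsRogersFunction F)
    (hreal : ∀ ξ : ℝ, 0 < ξ → (F (ξ : ℂ)).im = 0) :
    ∃ Φ : ℝ → ℝ, IsCompleteBernstein Φ ∧
      ∀ ξ : ℝ, 0 < ξ → F (ξ : ℂ) = ((Φ (ξ ^ 2) : ℝ) : ℂ) := by
  have hre : ∀ w ∈ Metric.ball (0 : ℂ) 1, 1 - w ≠ 0 ∧ 0 < ((1 + w) / (1 - w)).re := by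
    intro w hw
    rw [mem_ball_zero_iff] at hw
    have h1 : 1 - w ≠ 0 := fun h0 => by
      rw [← sub_eq_zero.1 h0] at hw
      simp at hw
    refine ⟨h1, ?_⟩
    have h2 : 0 < Complex.normSq (1 - w) := Complex.normSq_pos.2 h1
    have h3 : w.re * w.re + w.im * w.im < 1 := by
      rw [← Complex.normSq_apply, Complex.normSq_eq_norm_sq]
      nlinarith [norm_nonneg w]
    rw [Complex.div_re, ← add_div]
    refine div_pos ?_ h2
    simp only [Complex.add_re, Complex.sub_re, Complex.add_im, Complex.sub_im, Complex.one_re,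
      Complex.one_im]
    nlinarith
  have hdiff : DifferentiableOn ℂ
      (fun w : ℂ => F ((1 + w) / (1 - w)) / ((1 + w) / (1 - w))) (Metric.ball 0 1) := by
    have hc : DifferentiableOn ℂ (fun w : ℂ => (1 + w) / (1 - w)) (Metric.ball 0 1) :=
      DifferentiableOn.div (by fun_prop) (by fun_prop) fun w hw => (hre w hw).1
    refine (hF.1.comp hc fun w hw => (hre w hw).2).div hc fun w hw h0 => ?_
    have := (hre w hw).2
    simp [h0] at this
  obtain ⟨ν, hν⟩ := exists_finiteMeasure_integral_cosKernel hdiff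
    fun w hw => hF.2 _ (hre w hw).2
  have hFν : ∀ ξ : ℝ, 0 < ξ → (F ξ).re =
        ∫ x, cosKernel (ξ ^ 2) x ∂(ν : Measure (Icc (-1 : ℝ) 1)) := by
    intro ξ hξ
    have hcay : (1 + (((ξ - 1) / (ξ + 1) : ℝ) : ℂ)) / (1 - (((ξ - 1) / (ξ + 1) : ℝ) : ℂ)) = ξ := by
      have : (1 + (ξ - 1) / (ξ + 1)) / (1 - (ξ - 1) / (ξ + 1)) = ξ := by
        have h1 : ξ + 1 ≠ 0 := by positivity
        have h2 : 1 - (ξ - 1) / (ξ + 1) = 2 / (ξ + 1) := by field_simp; ring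
        rw [h2]; field_simp; ring
      exact_mod_cast congrArg Complex.ofReal this
    rw [← hν ξ hξ]
    simp only [hcay]
    rw [Complex.div_ofReal_re, mul_div_cancel₀ _ hξ.ne']
  refine ⟨fun η => (F (√η : ℝ)).re,
    isCompleteBernstein_of_eq_integral_cosKernel (ν : Measure _) fun η hη => ?_, fun ξ hξ => ?_⟩
  · rw [hFν _ (Real.sqrt_pos.2 hη), Real.sq_sqrt hη.le]
  · simp only [Real.sqrt_sq hξ.le]
    exact Complex.ext rfl (by simpa using hreal ξ hξ)
end
end
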